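/- arXiv:1302.1684 — 8 statements merged into one kernel-verified Lean document; each statement's English description precedes it below -/
import Mathlib

section
/- For every integer d ≥ 1 there exist a constant c' > 0 and N such that for all n ≥ N there is a d-tournament T on vertex set [n] with the property that every subset S ⊆ [n] with |S| ≥ c'·(log n)^{1/d} contains a (d+2)-element subset U ⊆ S that is a (d+2)-cycle of T. -/
open Finset

/-- The induced-orientation sign `(τ;σ)`: if `τ ⊆ σ` and `|τ| + 1 = |σ|`, with
`σ = {i₀ < … < i_d}` and `τ = σ \ {i_j}`, this is `(-1)^(d - j)`; otherwise `0`. -/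
def relSign (τ σ : Finset ℕ) : ℤ :=
  if τ ⊆ σ ∧ τ.card + 1 = σ.card then
    ∑ x ∈ σ \ τ, (-1 : ℤ) ^ (σ.card - 1 - (σ.filter (fun y => y < x)).card)
  else 0

/-- A `d`-tournament on vertex set `V`: a sign `±1` for each `(d+1)`-element subset of `V`
(encoded as a function on all finsets, vanishing elsewhere).  The column of the incidence
matrix indexed by a face `F` is the function `fun τ => ε F * relSign τ F`. -/
def IsTournament (V : Finset ℕ) (d : ℕ) (ε : Finset ℕ → ℤ) : Prop :=
  ∀ σ : Finset ℕ,
    (σ ⊆ V ∧ σ.card = d + 1 → ε σ = 1 ∨ ε σ = -1) ∧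
    (¬(σ ⊆ V ∧ σ.card = d + 1) → ε σ = 0)

/-- `C` is a cycle: a nonempty set of `(d+1)`-element subsets of `V` admitting positive
real coefficients whose weighted incidence-matrix column sum vanishes. -/
def IsCycle (V : Finset ℕ) (d : ℕ) (ε : Finset ℕ → ℤ) (C : Finset (Finset ℕ)) : Prop :=
  C.Nonempty ∧ (∀ F ∈ C, F ⊆ V ∧ F.card = d + 1) ∧
    ∃ v : Finset ℕ → ℝ, (∀ F ∈ C, 0 < v F) ∧
      ∀ τ : Finset ℕ, ∑ F ∈ C, v F * ((ε F : ℝ) * (relSign τ F : ℝ)) = 0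

def IsAcyclic (V : Finset ℕ) (d : ℕ) (ε : Finset ℕ → ℤ) : Prop :=
  ∀ C : Finset (Finset ℕ), ¬ IsCycle V d ε C

/-- `a_d(n)`: the number of acyclic `d`-tournaments on vertex set `[n]`. -/
noncomputable def acyclicCount (d n : ℕ) : ℕ :=
  Nat.card {ε : Finset ℕ → ℤ //
    IsTournament (Finset.range n) d ε ∧ IsAcyclic (Finset.range n) d ε}

/-- Restriction (subtournament) of `ε` to the subsets of `S`. -/
def restrict (S : Finset ℕ) (ε : Finset ℕ → ℤ) : Finset ℕ → ℤ :=
  fun σ => if σ ⊆ S then ε σ else 0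

/-- The link of the vertex `x`: it orients `τ` as the orientation induced on `τ`
by `τ ∪ {x}`. -/
def link (ε : Finset ℕ → ℤ) (x : ℕ) : Finset ℕ → ℤ :=
  fun τ => ε (insert x τ) * relSign τ (insert x τ)

/-- The degree sequence `A · 1⃗`. -/
def degSeq (V : Finset ℕ) (d : ℕ) (ε : Finset ℕ → ℤ) : Finset ℕ → ℤ :=
  fun τ => ∑ F ∈ V.powersetCard (d + 1), ε F * relSign τ F

/-- A `0/1`-cycle: a nonempty set of faces whose incidence-matrix columns sum to zero. -/
def Is01Cycle (V : Finset ℕ) (d : ℕ) (ε : Finset ℕ → ℤ) (C : Finset (Finset ℕ)) : Prop :=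
  C.Nonempty ∧ (∀ F ∈ C, F ⊆ V ∧ F.card = d + 1) ∧
    ∀ τ : Finset ℕ, ∑ F ∈ C, ε F * relSign τ F = 0

/-- `U` is a `(d+2)`-cycle: the set of all its `(d+1)`-element subsets is a cycle. -/
def IsDCycle (V : Finset ℕ) (d : ℕ) (ε : Finset ℕ → ℤ) (U : Finset ℕ) : Prop :=
  U ⊆ V ∧ U.card = d + 2 ∧ IsCycle V d ε (U.powersetCard (d + 1))

/-- A `d`-element subset `τ` of `V` is free if all nonzero entries of its row
in the incidence matrix have the same sign. -/
def IsFree (V : Finset ℕ) (d : ℕ) (ε : Finset ℕ → ℤ) (τ : Finset ℕ) : Prop :=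
  τ ⊆ V ∧ τ.card = d ∧
    ((∀ σ ∈ V.powersetCard (d + 1), 0 ≤ ε σ * relSign τ σ) ∨
     (∀ σ ∈ V.powersetCard (d + 1), ε σ * relSign τ σ ≤ 0))

/-- An elementary collapse at a free `d`-face `τ`: all faces containing `τ` get sign `0`. -/
def CollapseStep (V : Finset ℕ) (d : ℕ) (ε ε' : Finset ℕ → ℤ) : Prop :=
  ∃ τ : Finset ℕ, IsFree V d ε τ ∧ ε' = fun σ => if τ ⊆ σ then 0 else ε σ

/-- Collapsibility: a finite sequence of elementary collapses reaching the zero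
partial tournament. -/
def Collapsible (V : Finset ℕ) (d : ℕ) (ε : Finset ℕ → ℤ) : Prop :=
  Relation.ReflTransGen (CollapseStep V d) ε (fun _ => 0)

/-- Realizability in `ℝ^d`: the orientations are induced by a general-position embedding
of the vertices, i.e. `ε σ` is the sign of the (nonzero) orientation determinant of the
points of `σ` listed in increasing order. -/
def Realizable (n d : ℕ) (ε : Finset ℕ → ℤ) : Prop :=
  ∃ ι : ℕ → Fin d → ℝ, ∀ σ : Finset ℕ, σ ⊆ Finset.range n → ∀ hσ : σ.card = d + 1,
    0 < (ε σ : ℝ) * Matrix.det (Matrix.of fun k l : Fin d =>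
      ι ((σ.orderIsoOfFin hσ) k.succ : ℕ) l - ι ((σ.orderIsoOfFin hσ) 0 : ℕ) l)

lemma relSign_erase {U : Finset ℕ} {x : ℕ} (hx : x ∈ U) :
    relSign (U.erase x) U = (-1) ^ (U.card - 1 - (U.filter (· < x)).card) := by
  have hsub : U \ U.erase x = {x} := by
    ext y; simp only [mem_sdiff, mem_erase, mem_singleton]; grind
  rw [relSign, if_pos ⟨erase_subset _ _, card_erase_add_one hx⟩, hsub, sum_singleton]

lemma sum_powersetCard_eq_sum_erase {M : Type*} [AddCommMonoid M] {U : Finset ℕ} {k : ℕ}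
    (hU : U.card = k + 1) (g : Finset ℕ → M) :
    ∑ F ∈ U.powersetCard k, g F = ∑ x ∈ U, g (U.erase x) := by
  symm
  refine sum_bij (fun x _ => U.erase x) ?_ ?_ ?_ (fun _ _ => rfl)
  · intro x hx
    exact mem_powersetCard.2 ⟨erase_subset _ _, by rw [card_erase_of_mem hx, hU]; rfl⟩
  · intro x hx y hy h
    exact erase_injOn U hx hy h
  · intro F hF
    obtain ⟨hFU, hFc⟩ := mem_powersetCard.1 hF
    obtain ⟨x, hx⟩ := card_eq_one.1 (show (U \ F).card = 1 by
      rw [card_sdiff_of_subset hFU]; omega)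
    have hxU : x ∈ U \ F := hx ▸ mem_singleton_self x
    refine ⟨x, (mem_sdiff.1 hxU).1, ?_⟩
    rw [erase_eq, ← hx, Finset.sdiff_sdiff_eq_self hFU]

lemma relSign_mul_relSign_add {U : Finset ℕ} {x y : ℕ} (hx : x ∈ U) (hy : y ∈ U) (hxy : x < y) :
    relSign (U.erase x) U * relSign ((U.erase x).erase y) (U.erase x) +
      relSign (U.erase y) U * relSign ((U.erase y).erase x) (U.erase y) = 0 := by
  have hyx : y ∈ U.erase x := mem_erase.2 ⟨hxy.ne', hy⟩
  have hxy' : x ∈ U.erase y := mem_erase.2 ⟨hxy.ne, hx⟩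
  rw [relSign_erase hx, relSign_erase hy, relSign_erase hyx, relSign_erase hxy',
    card_erase_of_mem hx, card_erase_of_mem hy]
  have h₁ : (U.erase x).filter (· < y) = (U.filter (· < y)).erase x := filter_erase _ _ _
  have h₂ : (U.erase y).filter (· < x) = U.filter (· < x) := by
    ext z; simp only [mem_filter, mem_erase]; grind
  have hxm : x ∈ U.filter (· < y) := mem_filter.2 ⟨hx, hxy⟩
  rw [h₁, h₂, card_erase_of_mem hxm, ← pow_add, ← pow_add]
  have hlt : (U.filter (· < x)).card < (U.filter (· < y)).card := by
    refine card_lt_card ⟨fun z hz => ?_, fun h => ?_⟩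
    · simp only [mem_filter] at hz ⊢; exact ⟨hz.1, hz.2.trans hxy⟩
    · exact lt_irrefl x (mem_filter.1 (h hxm)).2
  have hle : (U.filter (· < y)).card < U.card :=
    card_lt_card ⟨filter_subset _ _, fun h => lt_irrefl y (mem_filter.1 (h hy)).2⟩
  generalize (U.filter (· < x)).card = a at *
  generalize (U.filter (· < y)).card = b at *
  rw [show U.card - 1 - a + (U.card - 1 - 1 - (b - 1)) =
    (U.card - 1 - b + (U.card - 1 - 1 - a)) + 1 by omega, pow_succ]
  ring

/-- The boundary of the boundary of a simplex vanishes. -/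
lemma sum_relSign_mul_relSign {U : Finset ℕ} {k : ℕ} (hU : U.card = k + 1) (τ : Finset ℕ) :
    ∑ F ∈ U.powersetCard k, relSign F U * relSign τ F = 0 := by
  rw [sum_powersetCard_eq_sum_erase hU]
  by_cases hτ : τ ⊆ U ∧ τ.card + 2 = U.card
  · obtain ⟨hτU, hτc⟩ := hτ
    have hsum : ∑ x ∈ U, relSign (U.erase x) U * relSign τ (U.erase x) =
        ∑ x ∈ U \ τ, relSign (U.erase x) U * relSign τ (U.erase x) := by
      refine (sum_subset sdiff_subset fun x hx hx' => ?_).symm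
      have hxτ : x ∈ τ := by simpa [hx] using hx'
      rw [relSign.eq_def τ, if_neg (fun h => notMem_erase x U (h.1 hxτ)), mul_zero]
    obtain ⟨x, y, hne, hxy⟩ := card_eq_two.1 (show (U \ τ).card = 2 by
      rw [card_sdiff_of_subset hτU]; omega)
    rw [hsum]
    wlog hlt : x < y generalizing x y
    · exact this y x hne.symm (by rw [hxy, pair_comm]) (lt_of_le_of_ne (not_lt.1 hlt) hne.symm)
    have hx : x ∈ U := (mem_sdiff.1 (hxy ▸ mem_insert_self x {y} : x ∈ U \ τ)).1
    have hy : y ∈ U := (mem_sdiff.1 (hxy ▸ (by simp) : y ∈ U \ τ)).1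
    have hτe : τ = (U.erase x).erase y := by
      rw [← Finset.sdiff_sdiff_eq_self hτU, hxy]
      ext z; simp only [mem_sdiff, mem_insert, mem_singleton, mem_erase]; tauto
    rw [hxy, sum_pair hne]
    have h := relSign_mul_relSign_add hx hy hlt
    rwa [erase_right_comm (a := y) (b := x), ← hτe] at h
  · refine sum_eq_zero fun x hx => ?_
    rw [relSign.eq_def τ, if_neg, mul_zero]
    rintro ⟨h₁, h₂⟩
    refine hτ ⟨h₁.trans (erase_subset _ _), ?_⟩
    have := card_erase_add_one hx
    omega

lemma relSign_eq_one_or_neg_one {U F : Finset ℕ} (hF : F ⊆ U) (hc : F.card + 1 = U.card) :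
    relSign F U = 1 ∨ relSign F U = -1 := by
  obtain ⟨x, hx⟩ := card_eq_one.1 (show (U \ F).card = 1 by
    rw [card_sdiff_of_subset hF]; omega)
  rw [relSign, if_pos ⟨hF, hc⟩, hx, sum_singleton]
  exact neg_one_pow_eq_or ℤ _

lemma isDCycle_of_eq_relSign {V U : Finset ℕ} {d : ℕ} {ε : Finset ℕ → ℤ} (hUV : U ⊆ V)
    (hU : U.card = d + 2) (hε : ∀ F ∈ U.powersetCard (d + 1), ε F = relSign F U) :
    IsDCycle V d ε U := by
  refine ⟨hUV, hU, ?_, fun F hF => ?_, fun _ => 1, fun _ _ => one_pos, fun τ => ?_⟩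
  · exact powersetCard_nonempty.2 (by omega)
  · obtain ⟨h₁, h₂⟩ := mem_powersetCard.1 hF
    exact ⟨h₁.trans hUV, h₂⟩
  · have h := sum_relSign_mul_relSign hU τ
    have h' : ∑ F ∈ U.powersetCard (d + 1), ε F * relSign τ F = 0 :=
      (sum_congr rfl fun F hF => by rw [hε F hF]).trans h
    simpa using congrArg (Int.cast : ℤ → ℝ) h'

/-- The number of subsets of `F` avoiding a prescribed trace on each of a family of pairwise
disjoint `k`-element blocks. -/
lemma card_filter_forall_inter_ne_le {α ι : Type*} [DecidableEq α] [DecidableEq ι] {k : ℕ}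
    (B P : ι → Finset α) (I : Finset ι) (F : Finset α)
    (hB : ∀ i ∈ I, B i ⊆ F ∧ (B i).card = k) (hP : ∀ i ∈ I, P i ⊆ B i)
    (hdisj : (I : Set ι).PairwiseDisjoint B) :
    ((F.powerset.filter fun A => ∀ i ∈ I, A ∩ B i ≠ P i).card : ℝ) ≤
      2 ^ F.card * (1 - (2 ^ k)⁻¹) ^ I.card := by
  induction I using Finset.induction_on generalizing F with
  | empty => simp
  | insert i I hi ih =>
    obtain ⟨hBF, hBk⟩ := hB i (mem_insert_self _ _)
    have hdis : ∀ j ∈ I, Disjoint (B i) (B j) := fun j hj =>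
      hdisj (by simp) (by simp [hj]) (by rintro rfl; exact hi hj)
    have key := ih (F \ B i)
      (fun j hj => ⟨subset_sdiff.2 ⟨(hB j (mem_insert_of_mem hj)).1, (hdis j hj).symm⟩,
        (hB j (mem_insert_of_mem hj)).2⟩)
      (fun j hj => hP j (mem_insert_of_mem hj))
      (hdisj.subset (by simp))
    have hcard : (F.powerset.filter fun A => ∀ j ∈ insert i I, A ∩ B j ≠ P j).card ≤
        ((B i).powerset.erase (P i) ×ˢ
          ((F \ B i).powerset.filter fun A => ∀ j ∈ I, A ∩ B j ≠ P j)).card := by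
      refine card_le_card_of_injOn (fun A => (A ∩ B i, A \ B i)) ?_ ?_
      · intro A hA
        simp only [coe_filter, mem_powerset, Set.mem_ofPred_eq, mem_insert, forall_eq_or_imp] at hA
        simp only [coe_product, Set.mem_prod, mem_coe, mem_erase, mem_powerset, mem_filter]
        refine ⟨⟨hA.2.1, inter_subset_right⟩, sdiff_subset_sdiff hA.1 le_rfl, fun j hj => ?_⟩
        have : (A \ B i) ∩ B j = A ∩ B j := by
          ext z
          have : z ∈ B i → z ∉ B j := fun h => Finset.disjoint_left.1 (hdis j hj) h
          simp only [mem_inter, mem_sdiff]; tauto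
        rw [this]
        exact hA.2.2 j hj
      · intro A _ A' _ h
        rw [← sdiff_union_inter A (B i), ← sdiff_union_inter A' (B i)]
        simp only [Prod.mk.injEq] at h
        rw [h.1, h.2]
    have hPi : P i ∈ (B i).powerset := mem_powerset.2 (hP i (mem_insert_self _ _))
    rw [card_product, card_erase_of_mem hPi, card_powerset, hBk] at hcard
    have h2 : F.card = (F \ B i).card + k := by
      rw [← hBk, card_sdiff_add_card_eq_card hBF]
    have hcast : ((2 ^ k - 1 : ℕ) : ℝ) = 2 ^ k - 1 := by
      rw [Nat.cast_sub Nat.one_le_two_pow]; simp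
    refine (Nat.cast_le.2 hcard).trans ?_
    rw [Nat.cast_mul]
    refine (mul_le_mul_of_nonneg_left key (Nat.cast_nonneg _)).trans_eq ?_
    rw [hcast, card_insert_of_notMem hi, h2, pow_succ _ I.card, pow_add]
    field_simp

/-- A partial Steiner system: many `(k+1)`-subsets of `S`, no two of which share a `k`-subset. -/
lemma exists_pairwiseDisjoint_powersetCard {α : Type*} [DecidableEq α] (S : Finset α)
    (hS : S.Nonempty) (k : ℕ) :
    ∃ 𝒰 ⊆ S.powersetCard (k + 1), (S.card.choose (k + 1) : ℝ) / S.card ≤ 𝒰.card ∧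
      (𝒰 : Set (Finset α)).PairwiseDisjoint (powersetCard k) := by
  have : NeZero S.card := ⟨hS.card_pos.ne'⟩
  let e : S ≃ ZMod S.card := Fintype.equivOfCardEq (by simp [ZMod.card])
  let f : α → ZMod S.card := fun x => if h : x ∈ S then e ⟨x, h⟩ else 0
  have hf : Set.InjOn f S := by
    intro x hx y hy h
    have hx' : x ∈ S := hx
    have hy' : y ∈ S := hy
    simpa [f, hx', hy'] using h
  obtain ⟨c, -, hc⟩ := exists_le_card_fiber_of_nsmul_le_card_of_maps_to
    (s := S.powersetCard (k + 1)) (t := (univ : Finset (ZMod S.card)))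
    (f := fun U => ∑ u ∈ U, f u) (b := (S.card.choose (k + 1) : ℝ) / S.card)
    (fun _ _ => mem_univ _) univ_nonempty (by
      have : (S.card : ℝ) ≠ 0 := by exact_mod_cast hS.card_pos.ne'
      rw [card_univ, ZMod.card, card_powersetCard, nsmul_eq_mul, mul_div_cancel₀ _ this])
  refine ⟨_, filter_subset _ _, hc, ?_⟩
  intro U hU W hW hne
  refine Finset.disjoint_left.2 fun F hFU hFW => hne ?_
  simp only [coe_filter, mem_powersetCard, Set.mem_ofPred_eq] at hU hW
  rw [mem_powersetCard] at hFU hFW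
  have hext : ∀ {W : Finset α}, F ⊆ W → W.card = k + 1 → ∃ x, x ∉ F ∧ insert x F = W := by
    intro W hFW hW
    obtain ⟨x, hx, h⟩ := exists_eq_insert_iff.2 ⟨hFW, by rw [hFU.2, hW]⟩
    exact ⟨x, hx, h⟩
  obtain ⟨x, hx, rfl⟩ := hext hFU.1 hU.1.2
  obtain ⟨y, hy, rfl⟩ := hext hFW.1 hW.1.2
  have hxy := hU.2.trans hW.2.symm
  rw [sum_insert hx, sum_insert hy, add_left_inj] at hxy
  rw [hf (hU.1.1 (mem_insert_self _ _)) (hW.1.1 (mem_insert_self _ _)) hxy]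

/-- The tournament on `V` giving sign `1` to the faces in `A` and `-1` to the others. -/
def signTournament (V : Finset ℕ) (d : ℕ) (A : Finset (Finset ℕ)) (σ : Finset ℕ) : ℤ :=
  if σ ⊆ V ∧ σ.card = d + 1 then if σ ∈ A then 1 else -1 else 0

lemma isTournament_signTournament (V : Finset ℕ) (d : ℕ) (A : Finset (Finset ℕ)) :
    IsTournament V d (signTournament V d A) := by
  intro σ
  refine ⟨fun h => ?_, fun h => if_neg h⟩
  rw [signTournament, if_pos h]
  split_ifs <;> simp

lemma isDCycle_signTournament {V U : Finset ℕ} {d : ℕ} {A : Finset (Finset ℕ)} (hUV : U ⊆ V)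
    (hU : U.card = d + 2)
    (hA : A ∩ U.powersetCard (d + 1) = (U.powersetCard (d + 1)).filter (relSign · U = 1)) :
    IsDCycle V d (signTournament V d A) U := by
  refine isDCycle_of_eq_relSign hUV hU fun F hF => ?_
  have hF' := mem_powersetCard.1 hF
  have hmem : F ∈ A ↔ relSign F U = 1 := by
    simpa [hF] using Finset.ext_iff.1 hA F
  rw [signTournament, if_pos ⟨hF'.1.trans hUV, hF'.2⟩]
  have := relSign_eq_one_or_neg_one hF'.1 (by omega)
  grind

/-- Few tournaments have no `(d+2)`-cycle inside a given set `S`. -/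
lemma card_filter_forall_not_isDCycle_le {V S : Finset ℕ} {d : ℕ} (hSV : S ⊆ V)
    (hS : S.Nonempty) [DecidablePred fun A => ∀ U ⊆ S, ¬ IsDCycle V d (signTournament V d A) U] :
    (((V.powersetCard (d + 1)).powerset.filter
        fun A => ∀ U ⊆ S, ¬ IsDCycle V d (signTournament V d A) U).card : ℝ) ≤
      2 ^ (V.powersetCard (d + 1)).card *
        Real.exp (-((2 ^ (d + 2))⁻¹ * (S.card.choose (d + 2) / S.card))) := by
  obtain ⟨𝒰, h𝒰, hcard, hdisj⟩ := exists_pairwiseDisjoint_powersetCard S hS (d + 1)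
  have hle := card_filter_forall_inter_ne_le (k := d + 2) (powersetCard (d + 1))
    (fun U => (U.powersetCard (d + 1)).filter (relSign · U = 1)) 𝒰 (V.powersetCard (d + 1))
    (fun U hU => by
      obtain ⟨h₁, h₂⟩ := mem_powersetCard.1 (h𝒰 hU)
      exact ⟨powersetCard_mono (h₁.trans hSV), by rw [card_powersetCard, h₂]; simp⟩)
    (fun _ _ => filter_subset _ _) hdisj
  refine (Nat.cast_le.2 (card_le_card fun A hA => ?_)).trans (hle.trans ?_)
  · rw [mem_filter] at hA ⊢
    refine ⟨hA.1, fun U hU h => ?_⟩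
    obtain ⟨h₁, h₂⟩ := mem_powersetCard.1 (h𝒰 hU)
    exact hA.2 U h₁ (isDCycle_signTournament (h₁.trans hSV) h₂ h)
  · have h1 : ((2 : ℝ) ^ (d + 2))⁻¹ ≤ 1 := inv_le_one_of_one_le₀ (one_le_pow₀ one_le_two)
    gcongr
    calc (1 - ((2 : ℝ) ^ (d + 2))⁻¹) ^ 𝒰.card
        ≤ Real.exp (-((2 : ℝ) ^ (d + 2))⁻¹) ^ 𝒰.card :=
          pow_le_pow_left₀ (by linarith) (Real.one_sub_le_exp_neg _) _
      _ = Real.exp (-(((2 : ℝ) ^ (d + 2))⁻¹ * 𝒰.card)) := by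
          rw [← Real.exp_nat_mul]; ring_nf
      _ ≤ _ := by gcongr

lemma pow_div_le_choose_div {s k : ℕ} (hs : 2 * (k + 1) ≤ s) :
    (s : ℝ) ^ k / (2 ^ (k + 1) * (k + 1).factorial) ≤ (s.choose (k + 1) : ℝ) / s := by
  have hs0 : (0 : ℝ) < s := by exact_mod_cast (by omega : 0 < s)
  have h := Nat.pow_le_choose (α := ℝ) (k + 1) s
  have hhalf : (s : ℝ) / 2 ≤ ((s + 1 - (k + 1) : ℕ) : ℝ) := by
    rw [div_le_iff₀ two_pos]; exact_mod_cast (by omega : s ≤ (s + 1 - (k + 1)) * 2)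
  rw [le_div_iff₀ hs0]
  calc (s : ℝ) ^ k / (2 ^ (k + 1) * (k + 1).factorial) * s
      = (s / 2) ^ (k + 1) / (k + 1).factorial := by
        rw [div_pow, pow_succ (s : ℝ)]; field_simp
    _ ≤ ((s + 1 - (k + 1) : ℕ) : ℝ) ^ (k + 1) / (k + 1).factorial := by gcongr
    _ ≤ _ := by exact_mod_cast h

/-- The union bound over all `s`-subsets of the vertex set. -/
lemma exists_signTournament_forall_card_eq {n d s : ℕ} (hn : 0 < n) (hs : 2 * (d + 2) ≤ s)
    (hlog : 4 ^ (d + 2) * (d + 2).factorial * Real.log n < (s : ℝ) ^ d) :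
    ∃ A : Finset (Finset ℕ), ∀ S ⊆ range n, S.card = s →
      ∃ U ⊆ S, IsDCycle (range n) d (signTournament (range n) d A) U := by
  classical
  by_contra! hcon
  set F := (range n).powersetCard (d + 1)
  have hcover : F.powerset ⊆ ((range n).powersetCard s).biUnion fun S =>
      F.powerset.filter fun A => ∀ U ⊆ S, ¬ IsDCycle (range n) d (signTournament (range n) d A) U := by
    intro A hA
    obtain ⟨S, hS, hSs, h⟩ := hcon A
    exact mem_biUnion.2 ⟨S, mem_powersetCard.2 ⟨hS, hSs⟩, mem_filter.2 ⟨hA, h⟩⟩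
  have hle := (card_le_card hcover).trans card_biUnion_le
  set E := Real.exp (-((2 ^ (d + 2))⁻¹ * ((s.choose (d + 2) : ℝ) / s))) with hE
  have hsum : ((2 : ℝ) ^ F.card) ≤ n.choose s * (2 ^ F.card * E) := by
    calc ((2 : ℝ) ^ F.card) = (F.powerset.card : ℝ) := by rw [card_powerset]; simp
      _ ≤ _ := Nat.cast_le.2 hle
      _ ≤ ∑ S ∈ (range n).powersetCard s, 2 ^ F.card * E := by
        rw [Nat.cast_sum]
        refine sum_le_sum fun S hS => ?_
        obtain ⟨h₁, h₂⟩ := mem_powersetCard.1 hS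
        rw [hE, ← h₂]
        exact card_filter_forall_not_isDCycle_le h₁ (card_pos.1 (by omega))
      _ = _ := by simp
  have hs0 : (0 : ℝ) < s := by exact_mod_cast (by omega : 0 < s)
  have hn0 : (0 : ℝ) < n := by exact_mod_cast hn
  have hexp : (s : ℝ) * Real.log n < (2 ^ (d + 2))⁻¹ * ((s.choose (d + 2) : ℝ) / s) := by
    calc (s : ℝ) * Real.log n
        < s * (s ^ d / (4 ^ (d + 2) * (d + 2).factorial)) := by
          gcongr
          rw [lt_div_iff₀ (by positivity)]
          linarith
      _ = (2 ^ (d + 2))⁻¹ * ((s : ℝ) ^ (d + 1) / (2 ^ (d + 2) * (d + 2).factorial)) := by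
          rw [show (4 : ℝ) = 2 * 2 by norm_num, mul_pow, pow_succ (s : ℝ) d]
          field_simp
      _ ≤ _ := by
          exact mul_le_mul_of_nonneg_left (pow_div_le_choose_div (k := d + 1) hs) (by positivity)
  have hchoose : (n.choose s : ℝ) ≤ Real.exp (s * Real.log n) := by
    rw [Real.exp_nat_mul, Real.exp_log hn0]
    exact_mod_cast Nat.choose_le_pow n s
  have hlt : (n.choose s : ℝ) * E < 1 := by
    calc (n.choose s : ℝ) * E ≤ Real.exp (s * Real.log n) * E := by gcongr
      _ = Real.exp (s * Real.log n - (2 ^ (d + 2))⁻¹ * ((s.choose (d + 2) : ℝ) / s)) := by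
        rw [hE, ← Real.exp_add]; ring_nf
      _ < 1 := by rw [Real.exp_lt_one_iff]; linarith
  have hpos : (0 : ℝ) < 2 ^ F.card := by positivity
  nlinarith

/-- for all large `n` there is a `d`-tournament on `[n]` such that every
vertex subset of size `≥ c'·(log n)^{1/d}` contains a `(d+2)`-cycle. -/
theorem exists_tournament_all_large_sets_contain_cycle (d : ℕ) (hd : 1 ≤ d) :
    ∃ c' : ℝ, 0 < c' ∧ ∃ N : ℕ, ∀ n : ℕ, N ≤ n →
      ∃ ε : Finset ℕ → ℤ, IsTournament (Finset.range n) d ε ∧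
        ∀ S ⊆ Finset.range n, c' * Real.log n ^ ((1 : ℝ) / d) ≤ (S.card : ℝ) →
          ∃ U ⊆ S, IsDCycle (Finset.range n) d ε U := by
  set K : ℕ := 4 ^ (d + 2) * (d + 2).factorial with hK
  have hKd : 2 * (d + 2) ≤ K + 1 := by
    have h1 : d + 2 ≤ (d + 2).factorial := Nat.self_le_factorial _
    have h2 : 2 ≤ 4 ^ (d + 2) := (by norm_num : 2 ≤ 4 ^ 1).trans
      (Nat.pow_le_pow_right (by norm_num) (by omega))
    exact (Nat.mul_le_mul h2 h1).trans (Nat.le_succ _)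
  refine ⟨(K + 1 : ℕ), by positivity, 3, fun n hn => ?_⟩
  have hlog1 : 1 ≤ Real.log n := by
    rw [Real.le_log_iff_exp_le (by positivity)]
    have : (3 : ℝ) ≤ n := by exact_mod_cast hn
    linarith [Real.exp_one_lt_three]
  set L := Real.log n ^ ((1 : ℝ) / d) with hL
  have hL1 : 1 ≤ L := Real.one_le_rpow hlog1 (by positivity)
  have hLd : L ^ d = Real.log n := by
    rw [hL, one_div, Real.rpow_inv_natCast_pow (by linarith) (by omega)]
  set s := ⌈((K + 1 : ℕ) : ℝ) * L⌉₊ with hs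
  have hsle : ((K + 1 : ℕ) : ℝ) * L ≤ s := Nat.le_ceil _
  have hKs : K + 1 ≤ s := by
    have : ((K + 1 : ℕ) : ℝ) ≤ s := (le_mul_of_one_le_right (by positivity) hL1).trans hsle
    exact_mod_cast this
  obtain ⟨A, hA⟩ := exists_signTournament_forall_card_eq (n := n) (d := d) (s := s) (by omega)
    (hKd.trans hKs) (by
      calc (4 : ℝ) ^ (d + 2) * (d + 2).factorial * Real.log n
          = (K : ℝ) * Real.log n := by rw [hK]; push_cast; ring
        _ < ((K + 1 : ℕ) : ℝ) * Real.log n := by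
          have : (K : ℝ) < ((K + 1 : ℕ) : ℝ) := by exact_mod_cast Nat.lt_succ_self K
          gcongr
        _ ≤ ((K + 1 : ℕ) : ℝ) ^ d * L ^ d := by
          rw [hLd]
          gcongr
          exact le_self_pow₀ (by exact_mod_cast Nat.succ_pos K) (by omega)
        _ = (((K + 1 : ℕ) : ℝ) * L) ^ d := (mul_pow _ _ _).symm
        _ ≤ (s : ℝ) ^ d := by gcongr)
  refine ⟨_, isTournament_signTournament (range n) d A, fun S hS hSc => ?_⟩
  obtain ⟨S', hS', hcard⟩ := exists_subset_card_eq (Nat.ceil_le.2 hSc)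
  obtain ⟨U, hU, hcyc⟩ := hA S' (hS'.trans hS) hcard
  exact ⟨U, hU.trans hS', hcyc⟩
end

section
/- For every d-tournament T on vertex set [n] and every (d+3)-element subset W ⊆ [n], there exists a (d+2)-element subset U ⊆ W that is not a (d+2)-cycle of T. -/
open Finset

lemma relSign_eq_zero_of_not_subset {τ σ : Finset ℕ} (h : ¬ τ ⊆ σ) : relSign τ σ = 0 :=
  if_neg fun h' => h h'.1

lemma relSign_insert_ne_zero {τ : Finset ℕ} {a : ℕ} (ha : a ∉ τ) :
    relSign τ (insert a τ) ≠ 0 := by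
  simp [relSign, ha, Finset.insert_sdiff_cancel]

/-- In a `(d+2)`-cycle, the two facets meeting along a ridge `τ` induce opposite
orientations on `τ`. -/
lemma IsDCycle.exists_pos_ridge_relation {V : Finset ℕ} {d : ℕ} {ε : Finset ℕ → ℤ}
    {τ : Finset ℕ} {a b : ℕ} (hτ : τ.card = d) (ha : a ∉ τ) (hb : b ∉ τ) (hab : a ≠ b)
    (h : IsDCycle V d ε (insert a (insert b τ))) :
    ∃ p q : ℝ, 0 < p ∧ 0 < q ∧
      p * (link ε a τ : ℝ) + q * (link ε b τ : ℝ) = 0 := by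
  obtain ⟨-, -, -, -, v, hv, hsum⟩ := h
  have hmem : ∀ c ∉ τ, insert c τ ⊆ insert a (insert b τ) →
      insert c τ ∈ (insert a (insert b τ)).powersetCard (d + 1) := fun c hc hs =>
    Finset.mem_powersetCard.2 ⟨hs, by rw [Finset.card_insert_of_notMem hc, hτ]⟩
  have hma := hmem a ha (Finset.insert_subset_insert _ (Finset.subset_insert _ _))
  have hmb := hmem b hb (Finset.subset_insert _ _)
  have hne : insert a τ ≠ insert b τ := fun h => by
    have := h ▸ Finset.mem_insert_self a τ
    simp [hab, ha] at this
  refine ⟨v (insert a τ), v (insert b τ), hv _ hma, hv _ hmb, ?_⟩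
  have hτsum := hsum τ
  rw [← Finset.sum_subset (s₁ := {insert a τ, insert b τ}), Finset.sum_pair hne] at hτsum
  · simpa [link] using hτsum
  · simp [Finset.insert_subset_iff, hma, hmb]
  · intro F hF hF'
    obtain ⟨hFU, hFc⟩ := Finset.mem_powersetCard.1 hF
    rw [relSign_eq_zero_of_not_subset]
    · simp
    intro hs
    obtain ⟨c, hc, rfl⟩ := Finset.exists_eq_insert_iff.2 ⟨hs, by rw [hτ, hFc]⟩
    have := hFU (Finset.mem_insert_self c τ)
    simp only [Finset.mem_insert, hc, or_false] at this
    rcases this with rfl | rfl <;> simp at hF'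

/-- every `(d+3)`-element subset of the vertices contains a
`(d+2)`-element subset which is not a `(d+2)`-cycle. -/
theorem exists_non_cycle_in_d_plus_three (n d : ℕ) (hd : 1 ≤ d) (ε : Finset ℕ → ℤ)
    (hT : IsTournament (Finset.range n) d ε) :
    ∀ W ⊆ Finset.range n, W.card = d + 3 →
      ∃ U ⊆ W, U.card = d + 2 ∧ ¬ IsDCycle (Finset.range n) d ε U := by
  intro W hW hWc
  obtain ⟨τ, hτW, hτ⟩ := Finset.exists_subset_card_eq (show d ≤ W.card by omega)
  have hsd : (W \ τ).card = 3 := by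
    rw [Finset.card_sdiff_of_subset hτW]
    omega
  obtain ⟨x, y, z, hxy, hxz, hyz, hxyz⟩ := Finset.card_eq_three.1 hsd
  have hx : x ∈ W \ τ := by simp [hxyz]
  have hy : y ∈ W \ τ := by simp [hxyz]
  have hz : z ∈ W \ τ := by simp [hxyz]
  rw [Finset.mem_sdiff] at hx hy hz
  by_contra! hcyc
  have key : ∀ a b, a ∈ W ∧ a ∉ τ → b ∈ W ∧ b ∉ τ → a ≠ b →
      (link ε a τ : ℝ) * (link ε b τ : ℝ) < 0 := by
    intro a b ha hb hab
    obtain ⟨p, q, hp, hq, hpq⟩ := (hcyc (insert a (insert b τ))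
      (by simp [Finset.insert_subset_iff, ha.1, hb.1, hτW])
      (by simp [ha.2, hb.2, hab, hτ])).exists_pos_ridge_relation hτ ha.2 hb.2 hab
    have hFW : insert a τ ⊆ Finset.range n :=
      (Finset.insert_subset ha.1 hτW).trans hW
    have hFc : (insert a τ).card = d + 1 := by rw [Finset.card_insert_of_notMem ha.2, hτ]
    have hε : ε (insert a τ) ≠ 0 := by
      rcases (hT _).1 ⟨hFW, hFc⟩ with h | h <;> simp [h]
    have hl : (link ε a τ : ℝ) ≠ 0 :=
      Int.cast_ne_zero.2 (mul_ne_zero hε (relSign_insert_ne_zero ha.2))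
    have hl2 : 0 < p * (link ε a τ : ℝ) ^ 2 := by positivity
    have : q * ((link ε a τ : ℝ) * (link ε b τ : ℝ)) = -(p * (link ε a τ : ℝ) ^ 2) := by
      linear_combination (link ε a τ : ℝ) * hpq
    exact (pos_iff_neg_of_mul_neg (by linarith)).1 hq
  have h₁ := key x y hx hy hxy
  have h₂ := key x z hx hz hxz
  have h₃ := key y z hy hz hyz
  have h₄ := mul_neg_of_pos_of_neg (mul_pos_of_neg_of_neg h₁ h₂) h₃
  linarith [sq_nonneg ((link ε x τ : ℝ) * (link ε y τ : ℝ) * (link ε z τ : ℝ))]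
end

section
/- Let T be a d-tournament on vertex set [n]. Then: (i) if T is realizable in ℝ^d then T is collapsible; (ii) if T is collapsible then T is acyclic; (iii) if T is acyclic then T has no 0/1-cycle; (iv) if T has no 0/1-cycle then no (d+2)-element subset of [n] is a (d+2)-cycle of T. -/
open Finset

theorem relSign_insert {P : Finset ℕ} {x : ℕ} (hx : x ∉ P) :
    relSign P (insert x P) = (-1) ^ (P.card - ((insert x P).filter (fun y => y < x)).card) := by
  have hsub : insert x P \ P = {x} := by
    ext y; simp only [mem_sdiff, mem_insert, mem_singleton]; grind
  have hcond : P ⊆ insert x P ∧ P.card + 1 = (insert x P).card :=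
    ⟨subset_insert x P, (card_insert_of_notMem hx).symm⟩
  rw [relSign, if_pos hcond, hsub, sum_singleton, card_insert_of_notMem hx, Nat.add_sub_cancel]

theorem exists_eq_insert_of_card {P σ : Finset ℕ} (h : P ⊆ σ) (hc : P.card + 1 = σ.card) :
    ∃ x, x ∉ P ∧ σ = insert x P := by
  have h1 : (σ \ P).card = 1 := by rw [card_sdiff_of_subset h]; omega
  obtain ⟨x, hx⟩ := card_eq_one.1 h1
  have hxm : x ∈ σ \ P := hx ▸ mem_singleton_self x
  refine ⟨x, (mem_sdiff.1 hxm).2, ?_⟩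
  rw [insert_eq, ← hx, sdiff_union_of_subset h]

theorem relSign_ne_zero {P σ : Finset ℕ} (h : P ⊆ σ) (hc : P.card + 1 = σ.card) :
    relSign P σ ≠ 0 := by
  obtain ⟨x, hx, rfl⟩ := exists_eq_insert_of_card h hc
  rw [relSign_insert hx]
  exact pow_ne_zero _ (by norm_num)

theorem relSign_abs {P σ : Finset ℕ} (h : P ⊆ σ) (hc : P.card + 1 = σ.card) :
    |(relSign P σ : ℝ)| = 1 := by
  obtain ⟨x, hx, rfl⟩ := exists_eq_insert_of_card h hc
  rw [relSign_insert hx]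
  push_cast
  rw [abs_pow, abs_neg, abs_one, one_pow]

theorem relSign_eq_zero {P σ : Finset ℕ} (h : ¬ P ⊆ σ) : relSign P σ = 0 :=
  if_neg fun h' => h h'.1

/-- A collapsible partial tournament has no cycle within its support. -/
theorem Collapsible.not_isCycle {V : Finset ℕ} {d : ℕ} {ε : Finset ℕ → ℤ}
    (h : Collapsible V d ε) (C : Finset (Finset ℕ)) (hC : ∀ F ∈ C, ε F ≠ 0) :
    ¬ IsCycle V d ε C := by
  induction h using Relation.ReflTransGen.head_induction_on with
  | refl =>
    rintro ⟨⟨F, hF⟩, -⟩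
    exact hC F hF rfl
  | @head ε ε' hstep _ ih =>
    obtain ⟨τ, ⟨-, hτc, hfree⟩, rfl⟩ := hstep
    rintro ⟨hne, hCV, v, hv, hsum⟩
    have hτ : ∀ F ∈ C, ¬ τ ⊆ F := by
      intro F hF hsub
      have hne0 : v F * ((ε F : ℝ) * (relSign τ F : ℝ)) ≠ 0 := by
        refine mul_ne_zero (hv F hF).ne' (mul_ne_zero ?_ ?_)
        · exact_mod_cast hC F hF
        · exact_mod_cast relSign_ne_zero hsub (by rw [hτc, (hCV F hF).2])
      rcases hfree with hpos | hneg
      · refine hne0 ((sum_eq_zero_iff_of_nonneg fun G hG => ?_).1 (hsum τ) F hF)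
        exact mul_nonneg (hv G hG).le (by exact_mod_cast hpos G (mem_powersetCard.2 (hCV G hG)))
      · refine hne0 ((sum_eq_zero_iff_of_nonpos fun G hG => ?_).1 (hsum τ) F hF)
        exact mul_nonpos_of_nonneg_of_nonpos (hv G hG).le
          (by exact_mod_cast hneg G (mem_powersetCard.2 (hCV G hG)))
    refine ih (fun F hF => by simpa [hτ F hF] using hC F hF) ⟨hne, hCV, v, hv, fun ρ => ?_⟩
    rw [← hsum ρ]
    exact sum_congr rfl fun F hF => by simp [hτ F hF]

theorem Is01Cycle.isCycle {V : Finset ℕ} {d : ℕ} {ε : Finset ℕ → ℤ} {C : Finset (Finset ℕ)}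
    (h : Is01Cycle V d ε C) : IsCycle V d ε C := by
  refine ⟨h.1, h.2.1, fun _ => 1, fun _ _ => one_pos, fun τ => ?_⟩
  simp only [one_mul]
  exact_mod_cast h.2.2 τ

/-- The coefficients of a `(d+2)`-cycle are all equal, so it is a `0/1`-cycle. -/
theorem IsDCycle.is01Cycle {V : Finset ℕ} {d : ℕ} {ε : Finset ℕ → ℤ} (hT : IsTournament V d ε)
    {U : Finset ℕ} (h : IsDCycle V d ε U) : Is01Cycle V d ε (U.powersetCard (d + 1)) := by
  obtain ⟨hUV, hUc, hne, hCV, v, hv, hsum⟩ := h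
  have herase : ∀ F ∈ U.powersetCard (d + 1), ∃ a ∈ U, F = U.erase a := by
    intro F hF
    obtain ⟨hFU, hFc⟩ := mem_powersetCard.1 hF
    obtain ⟨a, ha, rfl⟩ := exists_eq_insert_of_card hFU (by omega)
    exact ⟨a, mem_insert_self _ _, (erase_insert ha).symm⟩
  have habs : ∀ F ∈ U.powersetCard (d + 1), ∀ τ ⊆ F, τ.card = d →
      |v F * ((ε F : ℝ) * (relSign τ F : ℝ))| = v F := by
    intro F hF τ hτ hτc
    rw [abs_mul, abs_mul, relSign_abs hτ (by rw [hτc, (hCV F hF).2]), mul_one,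
      abs_of_pos (hv F hF)]
    rcases (hT F).1 (hCV F hF) with h | h <;> simp [h]
  have heq : ∀ F ∈ U.powersetCard (d + 1), ∀ G ∈ U.powersetCard (d + 1), v F = v G := by
    intro F hF G hG
    by_cases hFG : F = G
    · rw [hFG]
    obtain ⟨a, ha, hFa⟩ := herase F hF
    obtain ⟨b, hb, hGb⟩ := herase G hG
    have hab : a ≠ b := by rintro rfl; exact hFG (hFa.trans hGb.symm)
    have hτF : (U.erase a).erase b ⊆ F := hFa ▸ erase_subset _ _
    have hτG : (U.erase a).erase b ⊆ G := by
      rw [hGb, erase_right_comm]; exact erase_subset _ _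
    have hτc : ((U.erase a).erase b).card = d := by
      rw [card_erase_of_mem (mem_erase.2 ⟨hab.symm, hb⟩), card_erase_of_mem ha]; omega
    have hs := hsum ((U.erase a).erase b)
    rw [sum_eq_add F G hFG] at hs
    · have h1 := habs F hF _ hτF hτc
      have h2 := habs G hG _ hτG hτc
      rw [eq_neg_of_add_eq_zero_left hs, abs_neg] at h1
      exact h1.symm.trans h2
    · intro K hK hKne
      obtain ⟨c, hc, hKc⟩ := herase K hK
      have hca : c ≠ a := by rintro rfl; exact hKne.1 (hKc.trans hFa.symm)
      have hcb : c ≠ b := by rintro rfl; exact hKne.2 (hKc.trans hGb.symm)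
      rw [relSign_eq_zero, Int.cast_zero, mul_zero, mul_zero]
      intro hsub
      have hcK : c ∈ K := hsub (mem_erase.2 ⟨hcb, mem_erase.2 ⟨hca, hc⟩⟩)
      rw [hKc] at hcK
      exact notMem_erase c U hcK
    · exact fun h => absurd hF h
    · exact fun h => absurd hG h
  obtain ⟨F, hF⟩ := id hne
  refine ⟨hne, hCV, fun τ => ?_⟩
  have hs := hsum τ
  rw [sum_congr rfl fun G hG => by rw [heq G hG F hF], ← mul_sum] at hs
  exact_mod_cast (mul_eq_zero.1 hs).resolve_left (hv F hF).ne'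

section Realization

variable {d : ℕ} (w : ℕ → Fin (d + 1) → ℝ)

/-- The `(d+1) × (d+1)` matrix whose rows are the vectors of `σ` in increasing order. -/
noncomputable def faceMatrix (σ : Finset ℕ) (hσ : σ.card = d + 1) :
    Matrix (Fin (d + 1)) (Fin (d + 1)) ℝ :=
  Matrix.of fun k => w (σ.orderEmbOfFin hσ k)

/-- The linear functional `v ↦ det (v, w_P)`, for a `d`-element set `P`. -/
noncomputable def sideFunctional (P : Finset ℕ) (hP : P.card = d) :
    (Fin (d + 1) → ℝ) →ₗ[ℝ] ℝ :=
  ∑ l : Fin (d + 1), ((-1) ^ (l : ℕ) *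
    (Matrix.of fun (k m : Fin d) => w (P.orderEmbOfFin hP k) (l.succAbove m)).det) •
      LinearMap.proj l

theorem sideFunctional_apply (P : Finset ℕ) (hP : P.card = d) (v : Fin (d + 1) → ℝ) :
    sideFunctional w P hP v = ∑ l : Fin (d + 1), (-1) ^ (l : ℕ) *
      (Matrix.of fun (k m : Fin d) => w (P.orderEmbOfFin hP k) (l.succAbove m)).det * v l := by
  simp [sideFunctional, LinearMap.sum_apply]

theorem sideFunctional_eq_det (P : Finset ℕ) (hP : P.card = d) (v : Fin (d + 1) → ℝ) :
    sideFunctional w P hP v =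
      (Matrix.of (Fin.cons v fun k => w (P.orderEmbOfFin hP k)) :
        Matrix (Fin (d + 1)) (Fin (d + 1)) ℝ).det := by
  rw [Matrix.det_succ_row_zero, sideFunctional_apply]
  refine sum_congr rfl fun l _ => ?_
  simp only [Matrix.of_apply, Fin.cons_zero]
  rw [mul_right_comm]
  rfl

theorem sideFunctional_eq_zero {P : Finset ℕ} (hP : P.card = d) {p : ℕ} (hp : p ∈ P) :
    sideFunctional w P hP (w p) = 0 := by
  rw [sideFunctional_eq_det]
  have hr : p ∈ Set.range (P.orderEmbOfFin hP) := by rw [range_orderEmbOfFin]; exact hp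
  obtain ⟨k, hk⟩ := hr
  refine Matrix.det_zero_of_row_eq (i := 0) (j := k.succ) (Fin.succ_ne_zero k).symm ?_
  ext m
  simp [hk]

/-- The orientation of `P ∪ {x}` is given by the side of the hyperplane through `P`
on which `x` lies. -/
theorem relSign_mul_det_faceMatrix {P : Finset ℕ} (hP : P.card = d) {x : ℕ} (hx : x ∉ P)
    (hσ : (insert x P).card = d + 1) :
    (faceMatrix w (insert x P) hσ).det =
      (relSign P (insert x P) : ℝ) * ((-1) ^ d * sideFunctional w P hP (w x)) := by
  have hr : x ∈ Set.range ((insert x P).orderEmbOfFin hσ) := by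
    rw [range_orderEmbOfFin]; exact mem_insert_self x P
  obtain ⟨j, hj⟩ := hr
  have hfilter : ((insert x P).filter (fun y => y < x)).card = j := by
    have : (insert x P).filter (fun y => y < x) =
        (Finset.Iio j).map ((insert x P).orderEmbOfFin hσ).toEmbedding := by
      ext y
      simp only [mem_filter, mem_map, mem_Iio]
      constructor
      · rintro ⟨hy, hyx⟩
        have hyr : y ∈ Set.range ((insert x P).orderEmbOfFin hσ) := by
          rw [range_orderEmbOfFin]; exact hy
        obtain ⟨i, rfl⟩ := hyr
        refine ⟨i, ?_, rfl⟩
        exact ((insert x P).orderEmbOfFin hσ).lt_iff_lt.1 (hyx.trans_eq hj.symm)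
      · rintro ⟨i, hi, rfl⟩
        refine ⟨orderEmbOfFin_mem _ hσ i, ?_⟩
        exact (((insert x P).orderEmbOfFin hσ).lt_iff_lt.2 hi).trans_eq hj
    rw [this, card_map, Fin.card_Iio]
  have hrest : (fun k => (insert x P).orderEmbOfFin hσ (j.succAbove k)) =
      P.orderEmbOfFin hP := by
    refine orderEmbOfFin_unique hP (fun k => ?_) ?_
    · refine mem_of_mem_insert_of_ne (orderEmbOfFin_mem _ hσ (j.succAbove k)) ?_
      intro h
      exact Fin.succAbove_ne j k (((insert x P).orderEmbOfFin hσ).injective (h.trans hj.symm))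
    · exact ((insert x P).orderEmbOfFin hσ).strictMono.comp (Fin.strictMono_succAbove j)
  have hsign : (relSign P (insert x P) : ℝ) * (-1) ^ d = (-1) ^ (j : ℕ) := by
    rw [relSign_insert hx, hfilter, hP]
    push_cast
    have hexp : d - (j : ℕ) + d = j + 2 * (d - j) := by omega
    rw [← pow_add, hexp, pow_add, pow_mul, neg_one_sq, one_pow, mul_one]
  rw [← mul_assoc, hsign, Matrix.det_succ_row _ j, sideFunctional_apply, mul_sum]
  refine sum_congr rfl fun l _ => ?_
  have hsub : (faceMatrix w (insert x P) hσ).submatrix j.succAbove l.succAbove =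
      Matrix.of fun (k m : Fin d) => w (P.orderEmbOfFin hP k) (l.succAbove m) := by
    ext k m
    simp only [faceMatrix, Matrix.submatrix_apply, Matrix.of_apply]
    rw [← congrFun hrest k]
  rw [hsub]
  simp only [faceMatrix, Matrix.of_apply, hj, pow_add]
  ring

/-- Vectors all of whose maximal minors are nonzero are linearly independent on each set of at
most `d + 1` indices. -/
theorem linearIndepOn_of_det_ne_zero {V : Finset ℕ} (hV : d + 1 ≤ V.card)
    (hw : ∀ σ ⊆ V, ∀ hσ : σ.card = d + 1, (faceMatrix w σ hσ).det ≠ 0)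
    {S : Finset ℕ} (hSV : S ⊆ V) (hS : S.card ≤ d + 1) :
    LinearIndepOn ℝ w (S : Set ℕ) := by
  obtain ⟨σ, hSσ, hσV, hσ⟩ := exists_subsuperset_card_eq hSV hS hV
  refine LinearIndepOn.mono ?_ (coe_subset.2 hSσ)
  have hli : LinearIndependent ℝ (faceMatrix w σ hσ).row :=
    Matrix.linearIndependent_rows_of_det_ne_zero (hw σ hσV hσ)
  exact (linearIndependent_equiv (σ.orderIsoOfFin hσ).toEquiv (f := fun i : σ => w i)).1 hli

/-- A generic functional vanishing on `w_P` which separates the rays of `V` modulo `w_P`. -/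
theorem exists_separating_functional {P V : Finset ℕ}
    (hli : ∀ i ∈ V, ∀ j ∈ V, LinearIndepOn ℝ w (↑(insert i (insert j P)) : Set ℕ))
    (hPV : Disjoint P V) {f : (Fin (d + 1) → ℝ) →ₗ[ℝ] ℝ} (hf : ∀ i ∈ V, 0 < f (w i)) :
    ∃ h : (Fin (d + 1) → ℝ) →ₗ[ℝ] ℝ, (∀ p ∈ P, h (w p) = 0) ∧
      ∀ i ∈ V, ∀ j ∈ V, i ≠ j → f (w j) * h (w i) ≠ f (w i) * h (w j) := by
  let K := Submodule.span ℝ (w '' (P : Set ℕ))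
  let u : V.offDiag → (Fin (d + 1) → ℝ) := fun q =>
    f (w q.1.2) • w q.1.1 - f (w q.1.1) • w q.1.2
  have hu : ∀ q : V.offDiag, u q ∉ K := by
    rintro ⟨⟨i, j⟩, hq⟩ hK
    obtain ⟨hi, hj, hij⟩ := mem_offDiag.1 hq
    have hiP : i ∉ insert j P := by
      rw [mem_insert, not_or]
      exact ⟨hij, fun h => disjoint_left.1 hPV h hi⟩
    have hspan : w i ∉ Submodule.span ℝ (w '' (↑(insert j P) : Set ℕ)) := by
      have := hli i hi j hj
      rw [coe_insert, linearIndepOn_insert (by exact_mod_cast hiP)] at this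
      exact this.2
    have hKle : K ≤ Submodule.span ℝ (w '' (↑(insert j P) : Set ℕ)) :=
      Submodule.span_mono (Set.image_mono (coe_subset.2 (subset_insert j P)))
    have hj' : w j ∈ Submodule.span ℝ (w '' (↑(insert j P) : Set ℕ)) :=
      Submodule.subset_span ⟨j, by simp, rfl⟩
    refine hspan ?_
    have hsum := Submodule.add_mem _ (hKle hK) (Submodule.smul_mem _ (f (w i)) hj')
    simp only [u, sub_add_cancel] at hsum
    exact (Submodule.smul_mem_iff _ (hf j hj).ne').1 hsum
  obtain ⟨h, hhK, hh⟩ := Module.Dual.exists_forall_mem_ne_zero_of_forall_exists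
    K.dualAnnihilator (fun q => Module.Dual.eval ℝ _ (u q)) fun q => by
      obtain ⟨h, hne, hle⟩ := Submodule.exists_le_ker_of_notMem (hu q)
      exact ⟨h, (Submodule.mem_dualAnnihilator h).2 fun y hy => hle hy, hne⟩
  refine ⟨h, fun p hp => ?_, fun i hi j hj hij heq => ?_⟩
  · exact (Submodule.mem_dualAnnihilator h).1 hhK _ (Submodule.subset_span ⟨p, hp, rfl⟩)
  · refine hh ⟨(i, j), mem_offDiag.2 ⟨hi, hj, hij⟩⟩ ?_
    simp [u, heq]

/-- Some vector of `V` is extreme modulo `w_P`. -/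
theorem exists_supporting_functional {P V : Finset ℕ} (hne : V.Nonempty)
    (hli : ∀ i ∈ V, ∀ j ∈ V, LinearIndepOn ℝ w (↑(insert i (insert j P)) : Set ℕ))
    (hPV : Disjoint P V) {f : (Fin (d + 1) → ℝ) →ₗ[ℝ] ℝ} (hfP : ∀ p ∈ P, f (w p) = 0)
    (hf : ∀ i ∈ V, 0 < f (w i)) :
    ∃ p ∈ V, ∃ g : (Fin (d + 1) → ℝ) →ₗ[ℝ] ℝ, (∀ q ∈ insert p P, g (w q) = 0) ∧
      ∀ i ∈ V.erase p, 0 < g (w i) := by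
  obtain ⟨h, hhP, hsep⟩ := exists_separating_functional w hli hPV hf
  obtain ⟨p, hp, hmin⟩ := exists_min_image V (fun i => h (w i) / f (w i)) hne
  refine ⟨p, hp, h - (h (w p) / f (w p)) • f, fun q hq => ?_, fun i hi => ?_⟩
  · rcases mem_insert.1 hq with rfl | hq
    · simp [div_mul_cancel₀ _ (hf q hp).ne']
    · simp [hhP q hq, hfP q hq]
  · obtain ⟨hip, hiV⟩ := mem_erase.1 hi
    have hle := hmin i hiV
    have hlt : h (w p) / f (w p) < h (w i) / f (w i) := by
      refine lt_of_le_of_ne hle fun heq => hsep i hiV p hp hip ?_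
      rw [div_eq_div_iff (hf p hp).ne' (hf i hiV).ne'] at heq
      linarith
    rw [lt_div_iff₀ (hf i hiV)] at hlt
    simpa using hlt

/-- A functional vanishing on `w_P` is a multiple of the side functional of `P`. -/
theorem exists_eq_smul_sideFunctional {P : Finset ℕ} (hP : P.card = d) {x : ℕ} (hx : x ∉ P)
    (hli : LinearIndepOn ℝ w (↑(insert x P) : Set ℕ))
    (hside : sideFunctional w P hP (w x) ≠ 0)
    {f : (Fin (d + 1) → ℝ) →ₗ[ℝ] ℝ} (hfP : ∀ p ∈ P, f (w p) = 0) :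
    ∃ c : ℝ, f = c • sideFunctional w P hP := by
  refine ⟨f (w x) / sideFunctional w P hP (w x), ?_⟩
  have hcard : Fintype.card (↑(insert x P) : Set ℕ) = Module.finrank ℝ (Fin (d + 1) → ℝ) := by
    rw [Module.finrank_fin_fun, ← hP, ← card_insert_of_notMem hx]
    simp
  refine LinearMap.ext_on_range (LinearIndependent.span_eq_top_of_card_eq_finrank' hli hcard) ?_
  rintro ⟨y, hy⟩
  rcases mem_insert.1 (mem_coe.1 hy) with rfl | hy
  · simp [div_mul_cancel₀ _ hside]
  · simp [hfP y hy, sideFunctional_eq_zero w hP hy]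

variable {n : ℕ} {ε : Finset ℕ → ℤ}

/-- If the signs come from vectors `w` and some functional vanishes on the `d`-set `P` and is
positive on `V`, then `P` is free as soon as only vertices of `V` extend it. -/
theorem isFree_of_functional {N : Finset ℕ} (hN : d + 1 ≤ N.card)
    (hw : ∀ σ ⊆ N, ∀ hσ : σ.card = d + 1, 0 < (ε σ : ℝ) * (faceMatrix w σ hσ).det)
    {P V : Finset ℕ} (hPN : P ⊆ N) (hP : P.card = d)
    {f : (Fin (d + 1) → ℝ) →ₗ[ℝ] ℝ} (hfP : ∀ p ∈ P, f (w p) = 0) (hf : ∀ i ∈ V, 0 < f (w i))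
    {ε' : Finset ℕ → ℤ} (hε' : ∀ σ, ε' σ = ε σ ∨ ε' σ = 0)
    (hsupp : ∀ σ, P ⊆ σ → ε' σ ≠ 0 → σ ⊆ P ∪ V) : IsFree N d ε' P := by
  refine ⟨hPN, hP, ?_⟩
  by_cases hall : ∀ σ ∈ N.powersetCard (d + 1), 0 ≤ ε' σ * relSign P σ
  · exact Or.inl hall
  right
  have key : ∀ σ ∈ N.powersetCard (d + 1), ε' σ * relSign P σ ≠ 0 →
      ∃ x ∈ V, 0 < (((ε' σ * relSign P σ : ℤ)) : ℝ) * ((-1) ^ d * sideFunctional w P hP (w x)) ∧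
        ∃ c : ℝ, f = c • sideFunctional w P hP := by
    intro σ hσ hne
    obtain ⟨hσN, hσc⟩ := mem_powersetCard.1 hσ
    have hPσ : P ⊆ σ := by
      by_contra h
      exact right_ne_zero_of_mul hne (relSign_eq_zero h)
    obtain ⟨x, hx, rfl⟩ := exists_eq_insert_of_card hPσ (by omega)
    have hε0 := left_ne_zero_of_mul hne
    have hxV : x ∈ V := by
      have := hsupp _ hPσ hε0 (mem_insert_self x P)
      exact (mem_union.1 this).resolve_left hx
    have hdet := hw _ hσN hσc
    rw [relSign_mul_det_faceMatrix w hP hx hσc, ← (hε' _).resolve_right hε0, ← mul_assoc] at hdet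
    refine ⟨x, hxV, by exact_mod_cast hdet, exists_eq_smul_sideFunctional w hP hx ?_ ?_ hfP⟩
    · exact linearIndepOn_of_det_ne_zero w hN
        (fun τ hτ hτc => right_ne_zero_of_mul (hw τ hτ hτc).ne') hσN hσc.le
    · exact right_ne_zero_of_mul (right_ne_zero_of_mul hdet.ne')
  push Not at hall
  obtain ⟨σ, hσ, hneg⟩ := hall
  obtain ⟨x, hxV, hpos, c, hc⟩ := key σ hσ hneg.ne
  intro ρ hρ
  by_contra! hρpos
  obtain ⟨y, hyV, hpos', -⟩ := key ρ hρ hρpos.ne'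
  have hx := hf x hxV
  have hy := hf y hyV
  rw [hc, LinearMap.smul_apply, smul_eq_mul] at hx hy
  have h1 := neg_of_mul_pos_right hpos (by exact_mod_cast hneg.le)
  have h2 := pos_of_mul_pos_right hpos' (by exact_mod_cast hρpos.le)
  have h3 := mul_pos hx hy
  have h4 := mul_neg_of_neg_of_pos h1 h2
  have h5 : ((-1 : ℝ) ^ d) * (-1) ^ d = 1 := by rw [← mul_pow]; norm_num
  nlinarith [mul_self_nonneg c]

/-- All faces containing `P` can be collapsed away, by sweeping around `w_P`. -/
theorem reflTransGen_collapseStep {N : Finset ℕ} (hN : d + 1 ≤ N.card)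
    (hw : ∀ σ ⊆ N, ∀ hσ : σ.card = d + 1, 0 < (ε σ : ℝ) * (faceMatrix w σ hσ).det)
    (hcard : ∀ σ, ε σ ≠ 0 → σ.card = d + 1) (k : ℕ) :
    ∀ (P V : Finset ℕ), P.card + k = d → P ⊆ N → V ⊆ N → Disjoint P V →
      ∀ f : (Fin (d + 1) → ℝ) →ₗ[ℝ] ℝ, (∀ p ∈ P, f (w p) = 0) → (∀ i ∈ V, 0 < f (w i)) →
      ∀ ε' : Finset ℕ → ℤ, (∀ σ, ε' σ = ε σ ∨ ε' σ = 0) →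
        (∀ σ, P ⊆ σ → ε' σ ≠ 0 → σ ⊆ P ∪ V) →
        Relation.ReflTransGen (CollapseStep N d) ε' (fun σ => if P ⊆ σ then 0 else ε' σ) := by
  induction k with
  | zero =>
    intro P V hP hPN _ _ f hfP hf ε' hε' hsupp
    exact .single ⟨P, isFree_of_functional w hN hw hPN hP hfP hf hε' hsupp, rfl⟩
  | succ k ih =>
    intro P V hP hPN
    induction V using Finset.strongInduction with
    | H V ihV =>
      intro hVN hPV f hfP hf ε' hε' hsupp
      rcases V.eq_empty_or_nonempty with rfl | hne
      · have hzero : (fun σ => if P ⊆ σ then 0 else ε' σ) = ε' := by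
          funext σ
          split_ifs with h
          · by_contra h0
            have hle := card_le_card (hsupp σ h (Ne.symm h0))
            have hσc := hcard σ fun h1 => h0 (((hε' σ).elim (·.trans h1) id).symm)
            rw [union_empty] at hle
            omega
          · rfl
        rw [hzero]
      · have hli : ∀ i ∈ V, ∀ j ∈ V, LinearIndepOn ℝ w (↑(insert i (insert j P)) : Set ℕ) := by
          intro i hi j hj
          refine linearIndepOn_of_det_ne_zero w hN
            (fun τ hτ hτc => right_ne_zero_of_mul (hw τ hτ hτc).ne') ?_ ?_
          · exact insert_subset (hVN hi) (insert_subset (hVN hj) hPN)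
          · have h1 := card_insert_le i (insert j P)
            have h2 := card_insert_le j P
            omega
        obtain ⟨p, hpV, g, hgP, hg⟩ := exists_supporting_functional w hne hli hPV hfP hf
        have hpP : p ∉ P := fun h => disjoint_left.1 hPV h hpV
        have hunion : insert p P ∪ V.erase p = P ∪ V := by
          rw [insert_union, ← union_insert, insert_erase hpV]
        have hstep₁ := ih (insert p P) (V.erase p) (by rw [card_insert_of_notMem hpP]; omega)
          (insert_subset (hVN hpV) hPN) ((erase_subset _ _).trans hVN)
          (disjoint_insert_left.2 ⟨notMem_erase p V, hPV.mono_right (erase_subset _ _)⟩)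
          g hgP hg ε' hε' fun σ hσ h0 => by
            rw [hunion]; exact hsupp σ ((subset_insert p P).trans hσ) h0
        have hstep₂ := ihV (V.erase p) (erase_ssubset hpV) ((erase_subset _ _).trans hVN)
          (hPV.mono_right (erase_subset _ _)) f hfP (fun i hi => hf i (mem_of_mem_erase hi))
          (fun σ => if insert p P ⊆ σ then 0 else ε' σ)
          (fun σ => by
            split_ifs
            · exact Or.inr rfl
            · exact hε' σ)
          (fun σ hσ h0 y hy => by
            have hnot : ¬ insert p P ⊆ σ := fun h => h0 (if_pos h)
            rw [if_neg hnot] at h0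
            have hyp : y ≠ p := by rintro rfl; exact hnot (insert_subset hy hσ)
            rcases mem_union.1 (hsupp σ hσ h0 hy) with h | h
            · exact mem_union_left _ h
            · exact mem_union_right _ (mem_erase.2 ⟨hyp, h⟩))
        refine hstep₁.trans ?_
        convert hstep₂ using 2 with σ
        by_cases h : P ⊆ σ
        · simp [h]
        · have : ¬ insert p P ⊆ σ := fun h' => h ((subset_insert p P).trans h')
          simp [h, this]

/-- The orientation determinant of affine points equals the determinant of their homogenizations. -/
theorem det_faceMatrix_cons_one (ι : ℕ → Fin d → ℝ) (σ : Finset ℕ) (hσ : σ.card = d + 1) :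
    (faceMatrix (fun i => Fin.cons 1 (ι i)) σ hσ).det =
      Matrix.det (Matrix.of fun k l : Fin d =>
        ι ((σ.orderIsoOfFin hσ) k.succ : ℕ) l - ι ((σ.orderIsoOfFin hσ) 0 : ℕ) l) := by
  set A := faceMatrix (fun i => (Fin.cons 1 (ι i) : Fin (d + 1) → ℝ)) σ hσ
  let B : Matrix (Fin (d + 1)) (Fin (d + 1)) ℝ :=
    Matrix.of fun i j => if i = 0 then A 0 j else A i j - A 0 j
  have hAB : A.det = B.det := by
    refine Matrix.det_eq_of_forall_row_eq_smul_add_const (fun i => if i = 0 then 0 else 1) 0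
      (if_pos rfl) fun i j => ?_
    by_cases hi : i = 0
    · simp [B, hi]
    · simp [B, hi]
  rw [hAB, Matrix.det_succ_column_zero, Fin.sum_univ_succ, sum_eq_zero]
  · simp only [B, A, faceMatrix, Matrix.of_apply, if_pos, Fin.cons_zero, Fin.val_zero, pow_zero,
      mul_one, one_mul, add_zero]
    congr 1
  · intro i _
    simp [B, A, faceMatrix]

theorem Realizable.collapsible (hn : d < n) (hT : IsTournament (range n) d ε)
    (h : Realizable n d ε) : Collapsible (range n) d ε := by
  obtain ⟨ι, hι⟩ := h
  have hcard : ∀ σ, ε σ ≠ 0 → σ.card = d + 1 := by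
    intro σ h0
    by_contra hc
    exact h0 ((hT σ).2 fun h => hc h.2)
  have := reflTransGen_collapseStep (fun i => (Fin.cons 1 (ι i) : Fin (d + 1) → ℝ))
    (N := range n) (by simpa using hn)
    (fun σ hσ hσc => by rw [det_faceMatrix_cons_one]; exact hι σ hσ hσc) hcard d ∅ (range n)
    (by simp) (empty_subset _) subset_rfl (disjoint_empty_left _) (LinearMap.proj 0) (by simp)
    (by simp) ε (fun _ => Or.inl rfl) fun σ _ h0 => by
      rw [empty_union]
      by_contra hc
      exact h0 ((hT σ).2 fun h => hc h.1)
  simpa [Collapsible] using this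

end Realization

/-- realizable ⇒ collapsible ⇒ acyclic ⇒ no `0/1`-cycle ⇒ no
`(d+2)`-cycle. -/
theorem acyclicity_implications (n d : ℕ) (hd : 1 ≤ d) (hn : d < n)
    (ε : Finset ℕ → ℤ) (hT : IsTournament (Finset.range n) d ε) :
    (Realizable n d ε → Collapsible (Finset.range n) d ε) ∧
    (Collapsible (Finset.range n) d ε → IsAcyclic (Finset.range n) d ε) ∧
    (IsAcyclic (Finset.range n) d ε →
      ∀ C : Finset (Finset ℕ), ¬ Is01Cycle (Finset.range n) d ε C) ∧
    ((∀ C : Finset (Finset ℕ), ¬ Is01Cycle (Finset.range n) d ε C) →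
      ∀ U : Finset ℕ, ¬ IsDCycle (Finset.range n) d ε U) := by
  refine ⟨fun h => h.collapsible hn hT, fun h C hC => ?_, fun h C hC => h C hC.isCycle,
    fun h U hU => h _ (hU.is01Cycle hT)⟩
  refine h.not_isCycle C (fun F hF => ?_) hC
  rcases (hT F).1 (hC.2.1 F hF) with h | h <;> simp [h]
end

section
/- There exists a 2-tournament T on vertex set [6] that has a 0/1-cycle, yet no 4-element subset of [6] is a 4-cycle of T. -/
open Finset

/-- The faces of the octahedron with pairs of antipodal vertices `{0, 1}`, `{2, 3}`, `{4, 5}`. -/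
def octahedron : Finset (Finset ℕ) :=
  {{0, 2, 4}, {0, 2, 5}, {0, 3, 4}, {0, 3, 5}, {1, 2, 4}, {1, 2, 5}, {1, 3, 4}, {1, 3, 5}}

/-- A `2`-tournament on six vertices that orients the octahedron coherently. -/
def octahedralTournament (σ : Finset ℕ) : ℤ :=
  if σ ⊆ Finset.range 6 ∧ σ.card = 3 then
    if σ ∈ ({{0, 2, 5}, {0, 3, 4}, {1, 2, 4}, {1, 3, 5}} : Finset (Finset ℕ)) then -1 else 1
  else 0

theorem isTournament_octahedralTournament :
    IsTournament (Finset.range 6) 2 octahedralTournament := by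
  intro σ
  refine ⟨fun h => ?_, fun h => if_neg h⟩
  rw [octahedralTournament, if_pos h]
  split_ifs <;> simp

theorem is01Cycle_octahedron :
    Is01Cycle (Finset.range 6) 2 octahedralTournament octahedron := by
  have hfaces : ∀ F ∈ octahedron, F ⊆ Finset.range 6 ∧ F.card = 2 + 1 := by decide +kernel
  refine ⟨by decide, hfaces, fun τ => ?_⟩
  by_cases hτ : τ ∈ (Finset.range 6).powerset
  · have h : ∀ τ ∈ (Finset.range 6).powerset,
        ∑ F ∈ octahedron, octahedralTournament F * relSign τ F = 0 := by decide +kernel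
    exact h τ hτ
  · refine Finset.sum_eq_zero fun F hF => ?_
    have hsub : ¬ τ ⊆ F := fun h => hτ (Finset.mem_powerset.2 (h.trans (hfaces F hF).1))
    simp [relSign, hsub]

/-- A set of faces is not a cycle if some row of the incidence matrix, restricted to these faces,
is nonzero and has all its entries of the same weak sign `s`. -/
theorem not_isCycle_of_row {V : Finset ℕ} {d : ℕ} {ε : Finset ℕ → ℤ} {C : Finset (Finset ℕ)}
    (τ : Finset ℕ) (s : ℤ) (hnonneg : ∀ F ∈ C, 0 ≤ s * (ε F * relSign τ F))
    (hpos : ∃ F ∈ C, 0 < s * (ε F * relSign τ F)) : ¬ IsCycle V d ε C := by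
  rintro ⟨-, -, v, hv, hsum⟩
  have key : 0 < ∑ F ∈ C, v F * ((s * (ε F * relSign τ F) : ℤ) : ℝ) := by
    refine Finset.sum_pos' (fun F hF => ?_) ?_
    · exact mul_nonneg (hv F hF).le (mod_cast hnonneg F hF)
    · obtain ⟨F, hF, h⟩ := hpos
      exact ⟨F, hF, mul_pos (hv F hF) (mod_cast h)⟩
  refine key.ne' ?_
  rw [← mul_zero (s : ℝ), ← hsum τ, Finset.mul_sum]
  refine Finset.sum_congr rfl fun F _ => ?_
  push_cast
  ring

/-- a `2`-tournament on `[6]` with a `0/1`-cycle but no `4`-cycle. -/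
theorem exists_01cyclic_without_4cycle :
    ∃ ε : Finset ℕ → ℤ, IsTournament (Finset.range 6) 2 ε ∧
      (∃ C : Finset (Finset ℕ), Is01Cycle (Finset.range 6) 2 ε C) ∧
      ∀ U ⊆ Finset.range 6, U.card = 4 →
        ¬ IsCycle (Finset.range 6) 2 ε (U.powersetCard 3) := by
  refine ⟨octahedralTournament, isTournament_octahedralTournament,
    ⟨octahedron, is01Cycle_octahedron⟩, fun U hU hcard => ?_⟩
  have hrow : ∀ U ∈ (Finset.range 6).powersetCard 4,
      ∃ τ ∈ U.powersetCard 2, ∃ s ∈ ({1, -1} : Finset ℤ),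
        (∀ F ∈ U.powersetCard 3, 0 ≤ s * (octahedralTournament F * relSign τ F)) ∧
          ∃ F ∈ U.powersetCard 3, 0 < s * (octahedralTournament F * relSign τ F) := by
    decide +kernel
  obtain ⟨τ, -, s, -, hnonneg, hpos⟩ := hrow U (Finset.mem_powersetCard.2 ⟨hU, hcard⟩)
  exact not_isCycle_of_row τ s hnonneg hpos
end

section
/- There exists a 2-tournament T on vertex set [10] that has a cycle (i.e., T is not acyclic), yet T has no 0/1-cycle. -/
open Finset

/-- The positively oriented triangles of a `19`-triangle complex: a `10`-vertex projective plane
whose only empty triangle `{3, 6, 8}` has been filled in. -/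
def positiveFaces : Finset (Finset ℕ) :=
  {{0, 2, 4}, {0, 4, 9}, {0, 6, 8}, {3, 6, 9}, {4, 5, 9}, {3, 5, 8}, {5, 7, 8}, {1, 6, 7},
    {1, 3, 6}, {1, 2, 3}}

/-- The negatively oriented triangles of the same complex. -/
def negativeFaces : Finset (Finset ℕ) :=
  {{1, 2, 4}, {0, 2, 8}, {2, 3, 8}, {0, 6, 9}, {3, 5, 9}, {6, 7, 8}, {4, 5, 7}, {1, 4, 7},
    {3, 6, 8}}

/-- Weights on the edges missing from the complex. -/
def edgeWeights : List (Finset ℕ × ℤ) :=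
  [({0, 1}, 2), ({0, 3}, -1), ({0, 5}, -2), ({0, 7}, -1), ({1, 5}, -2), ({1, 8}, -1),
    ({1, 9}, 1), ({2, 5}, -1), ({2, 6}, -1), ({2, 7}, -2), ({2, 9}, -2), ({3, 4}, -2),
    ({3, 7}, -1), ({4, 6}, 1), ({4, 8}, -2), ({5, 6}, -1), ({7, 9}, 2), ({8, 9}, 1)]

/-- The coboundary of a weighted list of faces. -/
def weightedCoboundary (L : List (Finset ℕ × ℤ)) (F : Finset ℕ) : ℤ :=
  (L.map fun p => p.2 * relSign p.1 F).sum

/-- The tournament that orients the complex so that it carries a cycle, and every other triangle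
according to the sign of the coboundary of `edgeWeights`. -/
def cyclicTournament (F : Finset ℕ) : ℤ :=
  if F ∈ (range 10).powersetCard 3 then
    if F ∈ positiveFaces then 1
    else if F ∈ negativeFaces then -1
    else (weightedCoboundary edgeWeights F).sign
  else 0

theorem relSign_eq_zero_of_notMem_powersetCard {V τ F : Finset ℕ} {d : ℕ}
    (hF : F ∈ V.powersetCard (d + 1)) (hτ : τ ∉ V.powersetCard d) : relSign τ F = 0 := by
  rw [mem_powersetCard] at hF hτ
  refine if_neg fun h => hτ ⟨h.1.trans hF.1, ?_⟩
  have := h.2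
  omega

theorem sum_mul_weightedCoboundary_eq_zero {C : Finset (Finset ℕ)} {ε : Finset ℕ → ℤ}
    (h : ∀ τ, ∑ F ∈ C, ε F * relSign τ F = 0) (L : List (Finset ℕ × ℤ)) :
    ∑ F ∈ C, ε F * weightedCoboundary L F = 0 := by
  induction L with
  | nil => simp [weightedCoboundary]
  | cons p L ih =>
    have hp : ∀ F, ε F * weightedCoboundary (p :: L) F
        = p.2 * (ε F * relSign p.1 F) + ε F * weightedCoboundary L F := fun F => by
      simp only [weightedCoboundary, List.map_cons, List.sum_cons]
      ring
    simp only [hp, sum_add_distrib, ← mul_sum, h, ih, mul_zero, add_zero]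

theorem isTournament_cyclicTournament : IsTournament (range 10) 2 cyclicTournament := by
  have key : ∀ F ∈ (range 10).powersetCard 3,
      cyclicTournament F = 1 ∨ cyclicTournament F = -1 := by
    decide +kernel
  refine fun σ => ⟨fun h => key σ (mem_powersetCard.2 h), fun h => ?_⟩
  rw [← mem_powersetCard] at h
  exact if_neg h

theorem faces_subset_powersetCard :
    positiveFaces ∪ negativeFaces ⊆ (range 10).powersetCard 3 := by
  decide +kernel

theorem isCycle_faces :
    IsCycle (range 10) 2 cyclicTournament (positiveFaces ∪ negativeFaces) := by
  refine ⟨⟨{0, 2, 4}, by decide⟩, fun F hF => mem_powersetCard.1 (faces_subset_powersetCard hF),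
    fun F => ((if F = {3, 6, 8} then 2 else 1 : ℤ) : ℝ), fun F _ => ?_, fun τ => ?_⟩
  · dsimp only
    split_ifs <;> norm_num
  · by_cases hτ : τ ∈ (range 10).powersetCard 2
    · have key : ∀ τ ∈ (range 10).powersetCard 2, ∑ F ∈ positiveFaces ∪ negativeFaces,
          (if F = {3, 6, 8} then 2 else 1 : ℤ) * (cyclicTournament F * relSign τ F) = 0 := by
        decide +kernel
      simpa only [Int.cast_sum, Int.cast_mul, Int.cast_zero] using
        congrArg (Int.cast : ℤ → ℝ) (key τ hτ)
    · refine sum_eq_zero fun F hF => ?_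
      rw [relSign_eq_zero_of_notMem_powersetCard (faces_subset_powersetCard hF) hτ]
      simp

theorem subset_faces_of_is01Cycle {C : Finset (Finset ℕ)}
    (hC : Is01Cycle (range 10) 2 cyclicTournament C) : C ⊆ positiveFaces ∪ negativeFaces := by
  have nonneg : ∀ F ∈ (range 10).powersetCard 3,
      0 ≤ cyclicTournament F * weightedCoboundary edgeWeights F := by
    decide +kernel
  have faces : ∀ F ∈ (range 10).powersetCard 3,
      cyclicTournament F * weightedCoboundary edgeWeights F = 0 →
        F ∈ positiveFaces ∪ negativeFaces := by
    decide +kernel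
  obtain ⟨-, hsub, hsum⟩ := hC
  have mem : ∀ F ∈ C, F ∈ (range 10).powersetCard 3 := fun F hF => mem_powersetCard.2 (hsub F hF)
  have zero := (sum_eq_zero_iff_of_nonneg fun F hF => nonneg F (mem F hF)).1
    (sum_mul_weightedCoboundary_eq_zero hsum edgeWeights)
  exact fun F hF => faces F (mem F hF) (zero F hF)

/-- Weights on the edges of the complex whose coboundary vanishes on no nonempty set of its
faces. -/
def separatingWeights : List (Finset ℕ × ℤ) :=
  [({0, 2}, 1), ({0, 8}, 4), ({0, 9}, -3), ({1, 2}, -3), ({1, 3}, -6), ({1, 6}, 7), ({1, 7}, 3),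
    ({3, 6}, 16), ({3, 8}, -3), ({3, 9}, 7), ({4, 5}, -1), ({5, 7}, -2), ({5, 9}, 4), ({6, 7},
    -1), ({6, 8}, 7), ({6, 9}, -6), ({7, 8}, 5)]

theorem mul_weightedCoboundary_separatingWeights :
    ∀ F ∈ positiveFaces ∪ negativeFaces,
      cyclicTournament F * weightedCoboundary separatingWeights F =
        3 - (if F = {0, 2, 4} then 2 else 0) - (if F = {3, 6, 8} then 29 else 0) := by
  decide +kernel

theorem not_is01Cycle_cyclicTournament (C : Finset (Finset ℕ)) :
    ¬ Is01Cycle (range 10) 2 cyclicTournament C := by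
  intro hC
  have hsum := sum_mul_weightedCoboundary_eq_zero hC.2.2 separatingWeights
  rw [sum_congr rfl fun F hF =>
    mul_weightedCoboundary_separatingWeights F (subset_faces_of_is01Cycle hC hF)] at hsum
  simp only [sum_sub_distrib, sum_const, sum_ite_eq', nsmul_eq_mul] at hsum
  have hpos := hC.1.card_pos
  split_ifs at hsum <;> omega

/-- a `2`-tournament on `[10]` which has a cycle but no `0/1`-cycle. -/
theorem exists_cyclic_without_01cycle :
    ∃ ε : Finset ℕ → ℤ, IsTournament (Finset.range 10) 2 ε ∧
      (∃ C : Finset (Finset ℕ), IsCycle (Finset.range 10) 2 ε C) ∧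
      ∀ C : Finset (Finset ℕ), ¬ Is01Cycle (Finset.range 10) 2 ε C :=
  ⟨cyclicTournament, isTournament_cyclicTournament, ⟨_, isCycle_faces⟩,
    not_is01Cycle_cyclicTournament⟩
end

section
/- There exists an acyclic 2-tournament on vertex set [10] in which no 2-element subset is free; in particular, this tournament is acyclic but not collapsible. -/
open Finset

/-- The coboundary of an integer-valued function on `d`-sets, at `σ`. -/
def coboundary (d : ℕ) (y : Finset ℕ → ℤ) (σ : Finset ℕ) : ℤ :=
  ∑ τ ∈ σ.powersetCard d, y τ * relSign τ σ

/-- The tournament of signs of the coboundary of `y`. -/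
def coboundaryTournament (V : Finset ℕ) (d : ℕ) (y : Finset ℕ → ℤ) (σ : Finset ℕ) : ℤ :=
  if σ ∈ V.powersetCard (d + 1) then (coboundary d y σ).sign else 0

lemma isTournament_coboundaryTournament {V : Finset ℕ} {d : ℕ} {y : Finset ℕ → ℤ}
    (hy : ∀ σ ∈ V.powersetCard (d + 1), coboundary d y σ ≠ 0) :
    IsTournament V d (coboundaryTournament V d y) := by
  intro σ
  rw [← Finset.mem_powersetCard]
  refine ⟨fun hσ => ?_, fun hσ => if_neg hσ⟩
  rw [coboundaryTournament, if_pos hσ]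
  rcases lt_or_gt_of_ne (hy σ hσ) with h | h
  · exact Or.inr (Int.sign_eq_neg_one_of_neg h)
  · exact Or.inl (Int.sign_eq_one_of_pos h)

lemma isAcyclic_of_coboundary_pos {V : Finset ℕ} {d : ℕ} {ε y : Finset ℕ → ℤ}
    (h : ∀ F ∈ V.powersetCard (d + 1), 0 < ε F * coboundary d y F) : IsAcyclic V d ε := by
  rintro C ⟨hne, hC, v, hv, hsum⟩
  have hrel : ∀ F ∈ C, ∑ τ ∈ V.powersetCard d, (y τ : ℝ) * relSign τ F = coboundary d y F := by
    intro F hF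
    rw [coboundary, Int.cast_sum]
    simp only [Int.cast_mul]
    symm
    refine Finset.sum_subset (Finset.powersetCard_mono (hC F hF).1) fun τ hτ hτF => ?_
    have hsub : ¬ τ ⊆ F := fun hsub =>
      hτF (Finset.mem_powersetCard.2 ⟨hsub, (Finset.mem_powersetCard.1 hτ).2⟩)
    simp [relSign, hsub]
  have hpos : 0 < ∑ F ∈ C, v F * ((ε F : ℝ) * coboundary d y F) :=
    Finset.sum_pos (fun F hF => mul_pos (hv F hF)
      (by exact_mod_cast h F (Finset.mem_powersetCard.2 (hC F hF)))) hne
  have hzero : ∑ F ∈ C, v F * ((ε F : ℝ) * coboundary d y F) = 0 := by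
    calc ∑ F ∈ C, v F * ((ε F : ℝ) * coboundary d y F)
        = ∑ F ∈ C, ∑ τ ∈ V.powersetCard d, y τ * (v F * (ε F * relSign τ F)) := by
          refine Finset.sum_congr rfl fun F hF => ?_
          rw [← hrel F hF, Finset.mul_sum, Finset.mul_sum]
          exact Finset.sum_congr rfl fun τ _ => by ring
      _ = ∑ τ ∈ V.powersetCard d, y τ * ∑ F ∈ C, v F * (ε F * relSign τ F) := by
          rw [Finset.sum_comm]
          simp only [Finset.mul_sum]
      _ = 0 := by simp [hsum]
  exact hpos.ne' hzero

lemma isAcyclic_coboundaryTournament {V : Finset ℕ} {d : ℕ} {y : Finset ℕ → ℤ}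
    (hy : ∀ σ ∈ V.powersetCard (d + 1), coboundary d y σ ≠ 0) :
    IsAcyclic V d (coboundaryTournament V d y) := by
  refine isAcyclic_of_coboundary_pos (y := y) fun F hF => ?_
  rw [coboundaryTournament, if_pos hF, Int.sign_mul_self_eq_abs]
  exact abs_pos.2 (hy F hF)

lemma not_collapsible_of_forall_not_isFree {V : Finset ℕ} {d : ℕ} {ε : Finset ℕ → ℤ}
    (hε : ε ≠ fun _ => 0) (hfree : ∀ τ, ¬ IsFree V d ε τ) : ¬ Collapsible V d ε := by
  intro h
  rcases Relation.ReflTransGen.cases_head h with h | ⟨_, ⟨τ, hτ, _⟩, _⟩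
  · exact hε h
  · exact hfree τ hτ

/-- Edge weights on `[10]`; entry `(a, b)` is used only for `a < b`. -/
def edgeWeightTable : List (List ℤ) :=
  [[0, 2, -4, -2, 3, 2, -2, 3, -1, 0],
   [0, 0, -1, 2, 4, -3, 4, 4, 4, 4],
   [0, 0, 0, -1, 3, -4, 3, 4, -3, -4],
   [0, 0, 0, 0, -3, -4, -3, 3, -4, 0],
   [0, 0, 0, 0, 0, -3, -1, -3, 3, 2],
   [0, 0, 0, 0, 0, 0, -3, -1, -1, 2],
   [0, 0, 0, 0, 0, 0, 0, 4, 3, -3],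
   [0, 0, 0, 0, 0, 0, 0, 0, 3, -4],
   [0, 0, 0, 0, 0, 0, 0, 0, 0, -3]]

/-- The weight of a pair `{a < b}` from the table. -/
def edgeWeight (τ : Finset ℕ) : ℤ :=
  ∑ a ∈ τ, ∑ b ∈ τ, (edgeWeightTable.getD a []).getD b 0

lemma coboundary_edgeWeight_ne_zero :
    ∀ σ ∈ (Finset.range 10).powersetCard (2 + 1), coboundary 2 edgeWeight σ ≠ 0 := by
  decide +kernel

lemma exists_neg_and_pos_coface_edgeWeight :
    ∀ τ ∈ (Finset.range 10).powersetCard 2,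
      (∃ c ∈ Finset.range 10 \ τ,
        coboundaryTournament (Finset.range 10) 2 edgeWeight (insert c τ) *
          relSign τ (insert c τ) < 0) ∧
      (∃ c ∈ Finset.range 10 \ τ,
        0 < coboundaryTournament (Finset.range 10) 2 edgeWeight (insert c τ) *
          relSign τ (insert c τ)) := by
  decide +kernel

lemma not_isFree_coboundaryTournament_edgeWeight (τ : Finset ℕ) :
    ¬ IsFree (Finset.range 10) 2 (coboundaryTournament (Finset.range 10) 2 edgeWeight) τ := by
  rintro ⟨hτ, hcard, hsign⟩
  have hmem : ∀ c ∈ Finset.range 10 \ τ, insert c τ ∈ (Finset.range 10).powersetCard (2 + 1) := by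
    intro c hc
    rw [Finset.mem_sdiff] at hc
    rw [Finset.mem_powersetCard, Finset.card_insert_of_notMem hc.2, hcard]
    exact ⟨Finset.insert_subset hc.1 hτ, rfl⟩
  obtain ⟨⟨c, hc, hneg⟩, c', hc', hpos⟩ :=
    exists_neg_and_pos_coface_edgeWeight τ (Finset.mem_powersetCard.2 ⟨hτ, hcard⟩)
  rcases hsign with h | h
  · exact hneg.not_ge (h _ (hmem c hc))
  · exact hpos.not_ge (h _ (hmem c' hc'))

/-- an acyclic `2`-tournament on `[10]` with no free `2`-element subset;
in particular it is acyclic but not collapsible. -/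
theorem exists_acyclic_not_collapsible :
    ∃ ε : Finset ℕ → ℤ, IsTournament (Finset.range 10) 2 ε ∧
      IsAcyclic (Finset.range 10) 2 ε ∧
      (∀ τ : Finset ℕ, ¬ IsFree (Finset.range 10) 2 ε τ) ∧
      ¬ Collapsible (Finset.range 10) 2 ε := by
  have htour := isTournament_coboundaryTournament coboundary_edgeWeight_ne_zero
  refine ⟨_, htour, isAcyclic_coboundaryTournament coboundary_edgeWeight_ne_zero,
    not_isFree_coboundaryTournament_edgeWeight,
    not_collapsible_of_forall_not_isFree (fun h => ?_)
      not_isFree_coboundaryTournament_edgeWeight⟩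
  have := (htour (Finset.range 3)).1 (by decide)
  rw [h] at this
  simp at this
end

section
/- There exists a collapsible 2-tournament on vertex set [5] that is not realizable in ℝ². -/
open Finset

/-- The tournament on `{0, …, 4}` whose only negative faces are `{0, 2, 4}` and `{1, 2, 4}`. -/
def twoNegativeFaces (σ : Finset ℕ) : ℤ :=
  if σ ∈ (Finset.range 5).powersetCard 3 then
    if σ = {0, 2, 4} ∨ σ = {1, 2, 4} then -1 else 1
  else 0

theorem isTournament_twoNegativeFaces : IsTournament (Finset.range 5) 2 twoNegativeFaces := by
  intro σ
  rw [← Finset.mem_powersetCard]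
  refine ⟨fun h => ?_, fun h => if_neg h⟩
  unfold twoNegativeFaces
  split_ifs <;> simp

instance (V : Finset ℕ) (d : ℕ) (ε : Finset ℕ → ℤ) (τ : Finset ℕ) :
    Decidable (IsFree V d ε τ) := by
  unfold IsFree
  infer_instance

/-- Setting to zero the faces containing `τ`. -/
def collapseAt (τ : Finset ℕ) (ε : Finset ℕ → ℤ) : Finset ℕ → ℤ :=
  fun σ => if τ ⊆ σ then 0 else ε σ

theorem collapsible_of_collapseAt {V : Finset ℕ} {d : ℕ} {ε : Finset ℕ → ℤ} (τ : Finset ℕ)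
    (hτ : IsFree V d ε τ) (h : Collapsible V d (collapseAt τ ε)) : Collapsible V d ε :=
  Relation.ReflTransGen.head ⟨τ, hτ, rfl⟩ h

theorem collapsible_twoNegativeFaces : Collapsible (Finset.range 5) 2 twoNegativeFaces := by
  refine collapsible_of_collapseAt {0, 1} (by decide +kernel) ?_
  refine collapsible_of_collapseAt {2, 3} (by decide +kernel) ?_
  refine collapsible_of_collapseAt {2, 4} (by decide +kernel) ?_
  refine collapsible_of_collapseAt {3, 4} (by decide +kernel) ?_
  have hzero : collapseAt {3, 4} (collapseAt {2, 4} (collapseAt {2, 3}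
      (collapseAt {0, 1} twoNegativeFaces))) = fun _ => 0 := by
    funext σ
    by_cases h : σ ∈ (Finset.range 5).powersetCard 3
    · revert σ
      decide +kernel
    · simp [collapseAt, twoNegativeFaces, h]
  rw [hzero]
  exact Relation.ReflTransGen.refl

/-- In the plane, a realization orients the face `{a, b, c}` by the cross product of the edge
vectors at `a`. -/
theorem pos_mul_cross_of_realization {n : ℕ} {ε : Finset ℕ → ℤ} {ι : ℕ → Fin 2 → ℝ}
    (h : ∀ σ : Finset ℕ, σ ⊆ Finset.range n → ∀ hσ : σ.card = 2 + 1,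
      0 < (ε σ : ℝ) * Matrix.det (Matrix.of fun k l : Fin 2 =>
        ι ((σ.orderIsoOfFin hσ) k.succ : ℕ) l - ι ((σ.orderIsoOfFin hσ) 0 : ℕ) l))
    {a b c : ℕ} (hab : a < b) (hbc : b < c) (hc : c < n) :
    0 < (ε {a, b, c} : ℝ) *
      ((ι b 0 - ι a 0) * (ι c 1 - ι a 1) - (ι b 1 - ι a 1) * (ι c 0 - ι a 0)) := by
  have hcard : ({a, b, c} : Finset ℕ).card = 2 + 1 :=
    Finset.card_eq_three.2 ⟨a, b, c, hab.ne, (hab.trans hbc).ne, hbc.ne, rfl⟩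
  have hsub : ({a, b, c} : Finset ℕ) ⊆ Finset.range n := by
    intro x hx
    simp only [Finset.mem_insert, Finset.mem_singleton] at hx
    rw [Finset.mem_range]
    omega
  have hvertices : ![a, b, c] = ({a, b, c} : Finset ℕ).orderEmbOfFin hcard := by
    refine Finset.orderEmbOfFin_unique hcard (fun i => ?_) ?_
    · fin_cases i <;> simp
    · intro i j hij
      fin_cases i <;> fin_cases j <;> simp_all
      omega
  have hdet := h _ hsub hcard
  simp only [Finset.coe_orderIsoOfFin_apply, ← hvertices] at hdet
  simpa [Matrix.det_fin_two] using hdet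

theorem not_realizable_twoNegativeFaces : ¬ Realizable 5 2 twoNegativeFaces := by
  rintro ⟨ι, h⟩
  have h₁₂ := pos_mul_cross_of_realization h (a := 0) (b := 1) (c := 2)
    (by simp) (by simp) (by simp)
  have h₁₃ := pos_mul_cross_of_realization h (a := 0) (b := 1) (c := 3)
    (by simp) (by simp) (by simp)
  have h₁₄ := pos_mul_cross_of_realization h (a := 0) (b := 1) (c := 4)
    (by simp) (by simp) (by simp)
  have h₂₃ := pos_mul_cross_of_realization h (a := 0) (b := 2) (c := 3)
    (by simp) (by simp) (by simp)
  have h₂₄ := pos_mul_cross_of_realization h (a := 0) (b := 2) (c := 4)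
    (by simp) (by simp) (by simp)
  have h₃₄ := pos_mul_cross_of_realization h (a := 0) (b := 3) (c := 4)
    (by simp) (by simp) (by simp)
  rw [show twoNegativeFaces {0, 1, 2} = 1 by decide +kernel] at h₁₂
  rw [show twoNegativeFaces {0, 1, 3} = 1 by decide +kernel] at h₁₃
  rw [show twoNegativeFaces {0, 1, 4} = 1 by decide +kernel] at h₁₄
  rw [show twoNegativeFaces {0, 2, 3} = 1 by decide +kernel] at h₂₃
  rw [show twoNegativeFaces {0, 2, 4} = -1 by decide +kernel] at h₂₄
  rw [show twoNegativeFaces {0, 3, 4} = 1 by decide +kernel] at h₃₄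
  -- The three products are the terms of a Grassmann–Plücker relation, so they sum to zero.
  have hsum := add_pos (add_pos (mul_pos h₁₂ h₃₄) (mul_pos h₁₃ h₂₄)) (mul_pos h₁₄ h₂₃)
  push_cast at hsum
  ring_nf at hsum
  exact lt_irrefl _ hsum

/-- a collapsible `2`-tournament on `[5]` which is not realizable in `ℝ²`. -/
theorem exists_collapsible_not_realizable :
    ∃ ε : Finset ℕ → ℤ, IsTournament (Finset.range 5) 2 ε ∧
      Collapsible (Finset.range 5) 2 ε ∧ ¬ Realizable 5 2 ε :=
  ⟨twoNegativeFaces, isTournament_twoNegativeFaces, collapsible_twoNegativeFaces,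
    not_realizable_twoNegativeFaces⟩
end

section
/- A d-tournament T on vertex set [n] has no 0/1-cycle if and only if T is uniquely determined among all d-tournaments on [n] by its degree sequence, i.e., every d-tournament S on [n] whose degree sequence equals that of T satisfies S = T. -/
open Finset

/-- Reversing a set `C` of faces changes the degree sequence by twice the column sum over `C`. -/
theorem degSeq_eq_add_two_mul_sum {V : Finset ℕ} {d : ℕ} {ε ε' : Finset ℕ → ℤ}
    {C : Finset (Finset ℕ)} (hC : C ⊆ V.powersetCard (d + 1))
    (hneg : ∀ F ∈ C, ε' F = -ε F) (heq : ∀ F ∉ C, ε' F = ε F) (τ : Finset ℕ) :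
    degSeq V d ε τ = degSeq V d ε' τ + 2 * ∑ F ∈ C, ε F * relSign τ F := by
  unfold degSeq
  rw [← sub_eq_iff_eq_add', ← Finset.sum_sub_distrib, Finset.mul_sum]
  symm
  refine Finset.sum_subset_zero_on_sdiff hC (fun F hF => ?_) (fun F hF => ?_)
  · rw [heq F (Finset.mem_sdiff.1 hF).2, sub_self]
  · rw [hneg F hF]
    ring

/-- a `d`-tournament has no `0/1`-cycle iff it is the unique
`d`-tournament on `[n]` with its degree sequence. -/
theorem no01cycle_iff_degSeq_determines (n d : ℕ) (hd : 1 ≤ d) (hn : d < n)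
    (ε : Finset ℕ → ℤ) (hT : IsTournament (Finset.range n) d ε) :
    (∀ C : Finset (Finset ℕ), ¬ Is01Cycle (Finset.range n) d ε C) ↔
      ∀ ε' : Finset ℕ → ℤ, IsTournament (Finset.range n) d ε' →
        degSeq (Finset.range n) d ε' = degSeq (Finset.range n) d ε → ε' = ε := by
  constructor
  · intro h ε' hT' hdeg
    by_contra hne
    let C := ((Finset.range n).powersetCard (d + 1)).filter fun F => ε' F ≠ ε F
    have hmem : ∀ F ∈ C, F ⊆ Finset.range n ∧ F.card = d + 1 := fun F hF =>
      Finset.mem_powersetCard.1 (Finset.mem_filter.1 hF).1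
    have heq : ∀ F ∉ C, ε' F = ε F := by
      intro F hF
      by_cases hF' : F ⊆ Finset.range n ∧ F.card = d + 1
      · by_contra hFne
        exact hF (Finset.mem_filter.2 ⟨Finset.mem_powersetCard.2 hF', hFne⟩)
      · rw [(hT F).2 hF', (hT' F).2 hF']
    have hneg : ∀ F ∈ C, ε' F = -ε F := by
      intro F hF
      have hFne := (Finset.mem_filter.1 hF).2
      rcases (hT F).1 (hmem F hF) with h₁ | h₁ <;>
        rcases (hT' F).1 (hmem F hF) with h₂ | h₂ <;> simp_all
    obtain ⟨F, hF⟩ := Function.ne_iff.1 hne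
    refine h C ⟨⟨F, by_contra fun hFC => hF (heq F hFC)⟩, hmem, fun τ => ?_⟩
    have := degSeq_eq_add_two_mul_sum (Finset.filter_subset _ _) hneg heq τ
    rw [hdeg] at this
    linarith
  · rintro h C ⟨⟨F, hF⟩, hmem, hsum⟩
    let ε' : Finset ℕ → ℤ := fun σ => if σ ∈ C then -ε σ else ε σ
    have hneg : ∀ F ∈ C, ε' F = -ε F := fun _ hF => if_pos hF
    have heq : ∀ F ∉ C, ε' F = ε F := fun _ hF => if_neg hF
    have hT' : IsTournament (Finset.range n) d ε' := by
      refine fun σ => ⟨fun hσ => ?_, fun hσ => ?_⟩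
      · by_cases hC : σ ∈ C
        · rw [hneg σ hC]
          rcases (hT σ).1 hσ with h₁ | h₁ <;> simp [h₁]
        · rw [heq σ hC]
          exact (hT σ).1 hσ
      · rw [heq σ fun hC => hσ (hmem σ hC), (hT σ).2 hσ]
    have hdeg : degSeq (Finset.range n) d ε' = degSeq (Finset.range n) d ε := by
      funext τ
      rw [degSeq_eq_add_two_mul_sum (fun F hF => Finset.mem_powersetCard.2 (hmem F hF))
        hneg heq τ, hsum τ, mul_zero, add_zero]
    have hself := congrFun (h ε' hT' hdeg) F
    rw [hneg F hF] at hself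
    rcases (hT F).1 (hmem F hF) with h₁ | h₁ <;> rw [h₁] at hself <;> norm_num at hself
end
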